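/- arXiv:2511.14115 — 3 statements merged into one kernel-verified Lean document; each statement's English description precedes it below -/
import Mathlib

section
/- Let N ≥ 3 and 2* = 2N/(N−2), and let S > 0 be a constant with the Sobolev property S (∫_{ℝ^N} |u|^{2*})^{2/2*} ≤ ∫_{ℝ^N} |∇u|² for every smooth compactly supported u : ℝ^N → ℝ. Let Ω ⊆ ℝ^N be an open set and φ ∈ L^{N/2}(Ω) with ‖φ‖_{L^{N/2}(Ω)} < S. Let v1, v2 be continuous on the closure of Ω and continuously differentiable on Ω, with v1 ≥ 0 on Ω, ∇v1 square-integrable on every compact subset of Ω, v2 ∈ L^{2*}(Ω) and ∇v2 ∈ L²(Ω; ℝ^N). Assume the weak differential inequality −Δ(v2 − v1) − φ(v2 − v1) ≤ 0 in Ω, i.e. for every nonnegative smooth function ξ with compact support contained in Ω one has ∫_Ω ∇(v2 − v1)·∇ξ ≤ ∫_Ω φ (v2 − v1) ξ. If v2 ≤ v1 on the topological boundary of Ω, then v2 ≤ v1 everywhere in Ω. -/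
open MeasureTheory Filter
open scoped ENNReal

noncomputable section

section

open Metric Set Topology
open scoped Convolution

/-- A compactly supported `C¹` function is a `C¹`-uniform limit of smooth functions supported near
its support. -/
lemma exists_contDiff_top_approx {E : Type*} [NormedAddCommGroup E] [NormedSpace ℝ E]
    [FiniteDimensional ℝ E] {ψ : E → ℝ} (hψ : ContDiff ℝ 1 ψ) (hc : HasCompactSupport ψ)
    {ε : ℝ} (hε : 0 < ε) {r : ℝ} (hr : 0 < r) :
    ∃ ζ : E → ℝ, ContDiff ℝ (⊤ : ℕ∞) ζ ∧ tsupport ζ ⊆ cthickening r (tsupport ψ) ∧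
      (∀ y, ‖ζ y - ψ y‖ ≤ ε) ∧ (∀ y, ‖fderiv ℝ ζ y - fderiv ℝ ψ y‖ ≤ ε) ∧
      ((∀ y, 0 ≤ ψ y) → ∀ y, 0 ≤ ζ y) := by
  borelize E
  let μ : Measure E := Measure.addHaar
  have hdc : Continuous (fderiv ℝ ψ) := hψ.continuous_fderiv one_ne_zero
  have hds : HasCompactSupport (fderiv ℝ ψ) := hc.fderiv ℝ
  have hu := hc.uniformContinuous_of_continuous hψ.continuous
  have hdu := hds.uniformContinuous_of_continuous hdc
  obtain ⟨d₁, hd₁, h₁⟩ := Metric.uniformContinuous_iff.1 hu ε hε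
  obtain ⟨d₂, hd₂, h₂⟩ := Metric.uniformContinuous_iff.1 hdu ε hε
  let d := min r (min d₁ d₂)
  have hd : 0 < d := lt_min hr (lt_min hd₁ hd₂)
  let ρ : ContDiffBump (0 : E) := ⟨d / 2, d, half_pos hd, half_lt_self hd⟩
  have hρl : LocallyIntegrable (ρ.normed μ) μ := ρ.continuous_normed.locallyIntegrable
  refine ⟨ρ.normed μ ⋆[ContinuousLinearMap.lsmul ℝ ℝ, μ] ψ, ?_, ?_, ?_, ?_, ?_⟩
  · exact ρ.hasCompactSupport_normed.contDiff_convolution_left _ ρ.contDiff_normed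
      hψ.continuous.locallyIntegrable
  · refine closure_minimal ?_ isClosed_cthickening
    refine (support_convolution_subset _).trans ?_
    rintro _ ⟨a, ha, b, hb, rfl⟩
    refine mem_cthickening_of_dist_le _ b r _ (subset_tsupport _ hb) ?_
    rw [ρ.support_normed_eq, mem_ball_zero_iff] at ha
    simpa using ha.le.trans (min_le_left _ _)
  · intro y
    rw [← dist_eq_norm]
    refine ρ.dist_normed_convolution_le hψ.continuous.aestronglyMeasurable fun x hx => (h₁ ?_).le
    exact (mem_ball.1 hx).trans_le ((min_le_right _ _).trans (min_le_left _ _))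
  · intro y
    rw [(hc.hasFDerivAt_convolution_right _ hρl hψ y).fderiv, ← dist_eq_norm]
    have hL : ContinuousLinearMap.precompR E (ContinuousLinearMap.lsmul ℝ ℝ : ℝ →L[ℝ] ℝ →L[ℝ] ℝ)
        = ContinuousLinearMap.lsmul ℝ ℝ := by
      ext a L
      simp
    rw [hL]
    refine ρ.dist_normed_convolution_le hdc.aestronglyMeasurable fun x hx => (h₂ ?_).le
    exact (mem_ball.1 hx).trans_le ((min_le_right _ _).trans (min_le_right _ _))
  · intro h0 y
    exact integral_nonneg fun t => mul_nonneg (ρ.nonneg_normed t) (h0 _)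

/-- Sequential form of `exists_contDiff_top_approx`, with all supports in a fixed compact subset of
a prescribed open set. -/
lemma exists_seq_contDiff_top_approx {E : Type*} [NormedAddCommGroup E] [NormedSpace ℝ E]
    [FiniteDimensional ℝ E] {ψ : E → ℝ} (hψ : ContDiff ℝ 1 ψ) (hc : HasCompactSupport ψ)
    {Ω : Set E} (hΩ : IsOpen Ω) (hs : tsupport ψ ⊆ Ω) :
    ∃ (K : Set E) (ζ : ℕ → E → ℝ), IsCompact K ∧ K ⊆ Ω ∧ (∀ n, ContDiff ℝ (⊤ : ℕ∞) (ζ n)) ∧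
      (∀ n, tsupport (ζ n) ⊆ K) ∧
      (∀ y, Tendsto (fun n => ζ n y) atTop (𝓝 (ψ y))) ∧
      (∀ y, Tendsto (fun n => fderiv ℝ (ζ n) y) atTop (𝓝 (fderiv ℝ ψ y))) ∧
      (∃ C, ∀ n y, ‖ζ n y‖ ≤ C) ∧ (∃ C, ∀ n y, ‖fderiv ℝ (ζ n) y‖ ≤ C) ∧
      ((∀ y, 0 ≤ ψ y) → ∀ n y, 0 ≤ ζ n y) := by
  have : ProperSpace E := FiniteDimensional.proper ℝ E
  obtain ⟨r, hr, hrΩ⟩ := hc.isCompact.exists_cthickening_subset_open hΩ hs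
  have hε : ∀ n : ℕ, (0 : ℝ) < 1 / (n + 1) := fun n => Nat.one_div_pos_of_nat
  have hε1 : ∀ n : ℕ, (1 : ℝ) / (n + 1) ≤ 1 := fun n => by
    rw [div_le_one (by positivity)]; linarith [n.cast_nonneg (α := ℝ)]
  choose ζ h1 h2 h3 h4 h5 using fun n : ℕ => exists_contDiff_top_approx hψ hc (hε n) hr
  obtain ⟨C, hC⟩ := hc.exists_bound_of_continuous hψ.continuous
  obtain ⟨D, hD⟩ := (hc.fderiv ℝ).exists_bound_of_continuous (hψ.continuous_fderiv one_ne_zero)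
  refine ⟨cthickening r (tsupport ψ), ζ, hc.isCompact.cthickening, hrΩ, h1, h2, ?_, ?_, ?_, ?_,
    fun h0 n => h5 n h0⟩
  · intro y
    rw [tendsto_iff_norm_sub_tendsto_zero]
    exact squeeze_zero (fun _ => norm_nonneg _) (fun n => h3 n y)
      tendsto_one_div_add_atTop_nhds_zero_nat
  · intro y
    rw [tendsto_iff_norm_sub_tendsto_zero]
    exact squeeze_zero (fun _ => norm_nonneg _) (fun n => h4 n y)
      tendsto_one_div_add_atTop_nhds_zero_nat
  · refine ⟨C + 1, fun n y => ?_⟩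
    have := norm_add_le (ψ y) (ζ n y - ψ y)
    rw [add_sub_cancel] at this
    linarith [h3 n y, hC y, hε1 n]
  · refine ⟨D + 1, fun n y => ?_⟩
    have := norm_add_le (fderiv ℝ ψ y) (fderiv ℝ (ζ n) y - fderiv ℝ ψ y)
    rw [add_sub_cancel] at this
    linarith [h4 n y, hD y, hε1 n]

/-- A Sobolev inequality for smooth compactly supported functions extends to `C¹` ones. -/
lemma sobolev_of_contDiff_one {E : Type*} [NormedAddCommGroup E] [InnerProductSpace ℝ E]
    [FiniteDimensional ℝ E] [MeasurableSpace E] [BorelSpace E] {p S : ℝ} (hp : 0 < p)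
    (hSob : ∀ u : E → ℝ, ContDiff ℝ (⊤ : ℕ∞) u → HasCompactSupport u →
      S * (∫ y, |u y| ^ p) ^ (2 / p) ≤ ∫ y, ‖fderiv ℝ u y‖ ^ 2)
    {u : E → ℝ} (hu : ContDiff ℝ 1 u) (hc : HasCompactSupport u) :
    S * (∫ y, |u y| ^ p) ^ (2 / p) ≤ ∫ y, ‖fderiv ℝ u y‖ ^ 2 := by
  obtain ⟨K, ζ, hK, -, h1, h2, h3, h4, ⟨C, hC⟩, ⟨D, hD⟩, -⟩ :=
    exists_seq_contDiff_top_approx hu hc isOpen_univ (subset_univ _)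
  have hζ0 : ∀ n y, y ∉ K → ζ n y = 0 := fun n y hy =>
    image_eq_zero_of_notMem_tsupport fun h => hy (h2 n h)
  have hdζ0 : ∀ n y, y ∉ K → fderiv ℝ (ζ n) y = 0 := fun n y hy =>
    image_eq_zero_of_notMem_tsupport fun h => hy (h2 n (tsupport_fderiv_subset ℝ h))
  have hint : ∀ M : ℝ, Integrable (K.indicator fun _ => M) volume := fun M =>
    (integrableOn_const hK.measure_lt_top.ne).integrable_indicator hK.measurableSet
  have t1 : Tendsto (fun n => ∫ y, |ζ n y| ^ p) atTop (𝓝 (∫ y, |u y| ^ p)) := by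
    refine tendsto_integral_of_dominated_convergence (K.indicator fun _ => C ^ p)
      (fun n => ?_) (hint _) (fun n => ae_of_all _ fun y => ?_) (ae_of_all _ fun y => ?_)
    · exact ((h1 n).continuous.abs.rpow_const fun _ => Or.inr hp.le).aestronglyMeasurable
    · by_cases hy : y ∈ K
      · rw [indicator_of_mem hy, Real.norm_of_nonneg (by positivity)]
        exact Real.rpow_le_rpow (abs_nonneg _) (hC n y) hp.le
      · simp [hζ0 n y hy, hy, hp.ne']
    · exact ((h3 y).abs).rpow_const (Or.inr hp.le)
  have t2 : Tendsto (fun n => ∫ y, ‖fderiv ℝ (ζ n) y‖ ^ 2) atTop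
      (𝓝 (∫ y, ‖fderiv ℝ u y‖ ^ 2)) := by
    refine tendsto_integral_of_dominated_convergence (K.indicator fun _ => D ^ 2)
      (fun n => ?_) (hint _) (fun n => ae_of_all _ fun y => ?_) (ae_of_all _ fun y => ?_)
    · exact (((h1 n).continuous_fderiv (by simp)).norm.pow 2).aestronglyMeasurable
    · by_cases hy : y ∈ K
      · rw [indicator_of_mem hy, Real.norm_of_nonneg (by positivity)]
        exact pow_le_pow_left₀ (norm_nonneg _) (hD n y) 2
      · simp [hdζ0 n y hy, hy]
    · exact (h4 y).norm.pow 2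
  refine le_of_tendsto_of_tendsto
    ((t1.rpow_const (Or.inr (by positivity))).const_mul S) t2 (Eventually.of_forall fun n => ?_)
  exact hSob _ (h1 n) (hK.of_isClosed_subset (isClosed_tsupport _) (h2 n))

/-- A weak differential inequality tested against smooth functions extends to `C¹` test
functions. -/
lemma weak_ineq_of_contDiff_one {E : Type*} [NormedAddCommGroup E] [InnerProductSpace ℝ E]
    [FiniteDimensional ℝ E] [MeasurableSpace E] [BorelSpace E] {Ω : Set E} (hΩ : IsOpen Ω)
    {W : E → E} (hW : ContinuousOn W Ω) {g : E → ℝ} (hg : LocallyIntegrableOn g Ω)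
    (hweak : ∀ ξ : E → ℝ, ContDiff ℝ (⊤ : ℕ∞) ξ → HasCompactSupport ξ → tsupport ξ ⊆ Ω →
      (∀ y, 0 ≤ ξ y) → ∫ y in Ω, fderiv ℝ ξ y (W y) ≤ ∫ y in Ω, g y * ξ y)
    {ξ : E → ℝ} (hξ : ContDiff ℝ 1 ξ) (hc : HasCompactSupport ξ) (hs : tsupport ξ ⊆ Ω)
    (h0 : ∀ y, 0 ≤ ξ y) :
    ∫ y in Ω, fderiv ℝ ξ y (W y) ≤ ∫ y in Ω, g y * ξ y := by
  obtain ⟨K, ζ, hK, hKΩ, h1, h2, h3, h4, ⟨C, hC⟩, ⟨D, hD⟩, h5⟩ :=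
    exists_seq_contDiff_top_approx hξ hc hΩ hs
  have hζ0 : ∀ n y, y ∉ K → ζ n y = 0 := fun n y hy =>
    image_eq_zero_of_notMem_tsupport fun h => hy (h2 n h)
  have hdζ0 : ∀ n y, y ∉ K → fderiv ℝ (ζ n) y = 0 := fun n y hy =>
    image_eq_zero_of_notMem_tsupport fun h => hy (h2 n (tsupport_fderiv_subset ℝ h))
  have hint : ∀ {f : E → ℝ}, IntegrableOn f K volume →
      Integrable (K.indicator f) (volume.restrict Ω) := fun hf =>
    (hf.integrable_indicator hK.measurableSet).restrict
  have hgK : IntegrableOn g K := hg.integrableOn_compact_subset hKΩ hK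
  have hgm : AEStronglyMeasurable g (volume.restrict Ω) := hg.aestronglyMeasurable
  have t1 : Tendsto (fun n => ∫ y in Ω, fderiv ℝ (ζ n) y (W y)) atTop
      (𝓝 (∫ y in Ω, fderiv ℝ ξ y (W y))) := by
    refine tendsto_integral_of_dominated_convergence (K.indicator fun y => D * ‖W y‖)
      (fun n => ?_) (hint ?_) (fun n => ae_of_all _ fun y => ?_) (ae_of_all _ fun y => ?_)
    · exact (((h1 n).continuous_fderiv (by simp)).continuousOn.clm_apply hW).aestronglyMeasurable
        hΩ.measurableSet
    · exact ((continuousOn_const.mul (hW.mono hKΩ).norm)).integrableOn_compact hK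
    · by_cases hy : y ∈ K
      · rw [indicator_of_mem hy]
        exact (fderiv ℝ (ζ n) y).le_of_opNorm_le (hD n y) _
      · simp [hdζ0 n y hy, hy]
    · exact ((ContinuousLinearMap.apply ℝ ℝ (W y)).continuous.tendsto _).comp (h4 y)
  have t2 : Tendsto (fun n => ∫ y in Ω, g y * ζ n y) atTop (𝓝 (∫ y in Ω, g y * ξ y)) := by
    refine tendsto_integral_of_dominated_convergence (K.indicator fun y => ‖g y‖ * C)
      (fun n => ?_) (hint ?_) (fun n => ae_of_all _ fun y => ?_) (ae_of_all _ fun y => ?_)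
    · exact hgm.mul (h1 n).continuous.aestronglyMeasurable
    · exact hgK.norm.mul_const C
    · by_cases hy : y ∈ K
      · rw [indicator_of_mem hy, norm_mul]
        exact mul_le_mul_of_nonneg_left (hC n y) (norm_nonneg _)
      · simp [hζ0 n y hy, hy]
    · exact (h3 y).const_mul _
  refine le_of_tendsto_of_tendsto t1 t2 (Eventually.of_forall fun n => ?_)
  exact hweak _ (h1 n) (hK.of_isClosed_subset (isClosed_tsupport _) (h2 n)) ((h2 n).trans hKΩ)
    (h5 h0 n)

/-- A smooth convex approximation of the positive part, vanishing on `(-∞, δ]`. -/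
lemma exists_smooth_convex_truncation {δ : ℝ} (hδ : 0 < δ) :
    ∃ F F' F'' : ℝ → ℝ, (∀ t, HasDerivAt F (F' t) t) ∧ (∀ t, HasDerivAt F' (F'' t) t) ∧
      Continuous F'' ∧ (∀ t ≤ δ, F t = 0) ∧ (∀ t, 0 ≤ F t) ∧ (∀ t, F t ≤ max t 0) ∧
      (∀ t, t - 2 * δ ≤ F t) ∧ (∀ t, 0 ≤ F' t) ∧ (∀ t, F' t ≤ 1) ∧ (∀ t, 0 ≤ F'' t) := by
  let f : ℝ → ℝ := fun t => Real.smoothTransition ((t - δ) / δ)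
  have hf : ContDiff ℝ 1 f :=
    (Real.smoothTransition.contDiff (n := 1)).comp ((contDiff_id.sub contDiff_const).div_const δ)
  have hfc : Continuous f := hf.continuous
  have hf0 : ∀ t, 0 ≤ f t := fun t => Real.smoothTransition.nonneg _
  have hf1 : ∀ t, f t ≤ 1 := fun t => Real.smoothTransition.le_one _
  have hfm : Monotone f := fun s t hst => Real.smoothTransition.monotone (by gcongr)
  have hi : ∀ a b, IntervalIntegrable f volume a b := fun a b => hfc.intervalIntegrable a b
  have hz : ∀ t ≤ δ, ∫ s in (0 : ℝ)..t, f s = 0 := fun t ht => by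
    refine intervalIntegral.integral_zero_ae (ae_of_all _ fun s hs => ?_)
    refine Real.smoothTransition.zero_of_nonpos (div_nonpos_of_nonpos_of_nonneg ?_ hδ.le)
    rw [mem_uIoc] at hs
    rcases hs with hs | hs <;> linarith
  have hn : ∀ t, 0 ≤ ∫ s in (0 : ℝ)..t, f s := fun t => by
    rcases le_total t δ with ht | ht
    · exact (hz t ht).ge
    · exact intervalIntegral.integral_nonneg (hδ.le.trans ht) fun s _ => hf0 s
  refine ⟨fun t => ∫ s in (0 : ℝ)..t, f s, f, deriv f, fun t => ?_, fun t => ?_,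
    hf.continuous_deriv le_rfl, hz, hn, fun t => ?_, fun t => ?_, hf0, hf1,
    fun t => hfm.deriv_nonneg⟩
  · exact intervalIntegral.integral_hasDerivAt_right (hi 0 t)
      (hfc.stronglyMeasurableAtFilter _ _) hfc.continuousAt
  · exact (hf.differentiable one_ne_zero t).hasDerivAt
  · rcases le_total t 0 with ht | ht
    · simp [hz t (ht.trans hδ.le)]
    · refine le_max_of_le_left ?_
      have := intervalIntegral.integral_mono_on ht (hi 0 t) (intervalIntegrable_const (c := (1 : ℝ)))
        fun s _ => hf1 s
      simpa using this
  · rcases le_total t (2 * δ) with ht | ht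
    · linarith [hn t]
    · have h1 : ∫ s in (2 * δ)..t, f s = t - 2 * δ := by
        rw [intervalIntegral.integral_congr (g := fun _ => (1 : ℝ))]
        · simp
        · intro s hs
          rw [uIcc_of_le ht] at hs
          refine Real.smoothTransition.one_of_one_le ?_
          rw [le_div_iff₀ hδ]
          linarith [hs.1]
      have := intervalIntegral.integral_add_adjacent_intervals (hi 0 (2 * δ)) (hi (2 * δ) t)
      linarith [hn (2 * δ)]

/-- A function that is `C¹` on an open set and vanishes outside a closed subset of it extends by
zero to a `C¹` function. -/
lemma contDiff_indicator_of_isClosed {E : Type*} [NormedAddCommGroup E] [NormedSpace ℝ E]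
    {Ω K : Set E} {f : E → ℝ} {n : WithTop ℕ∞} (hΩ : IsOpen Ω) (hK : IsClosed K) (hKΩ : K ⊆ Ω)
    (hf : ContDiffOn ℝ n f Ω) (h0 : ∀ y ∈ Ω, y ∉ K → f y = 0) :
    ContDiff ℝ n (Ω.indicator f) ∧ tsupport (Ω.indicator f) ⊆ K := by
  have hz : ∀ y ∉ K, Ω.indicator f y = 0 := fun y hy => by
    by_cases h : y ∈ Ω
    · rw [indicator_of_mem h, h0 y h hy]
    · exact indicator_of_notMem h f
  refine ⟨contDiff_iff_contDiffAt.2 fun y => ?_,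
    closure_minimal (fun y hy => by_contra fun h => hy (hz y h)) hK⟩
  by_cases hy : y ∈ K
  · refine (hf.contDiffAt (hΩ.mem_nhds (hKΩ hy))).congr_of_eventuallyEq ?_
    filter_upwards [hΩ.mem_nhds (hKΩ hy)] with z hz using indicator_of_mem hz f
  · refine (contDiffAt_const (c := (0 : ℝ))).congr_of_eventuallyEq ?_
    filter_upwards [hK.isOpen_compl.mem_nhds hy] with z h using hz z h

/-- Cutoff functions at scale `R` with gradient of size `O(1 / R)`. -/
lemma exists_cutoff (E : Type*) [NormedAddCommGroup E] [NormedSpace ℝ E] [FiniteDimensional ℝ E] :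
    ∃ C : ℝ, 0 ≤ C ∧ ∀ R : ℝ, 0 < R → ∃ η : E → ℝ, ContDiff ℝ 1 η ∧ HasCompactSupport η ∧
      (∀ y, 0 ≤ η y) ∧ (∀ y, η y ≤ 1) ∧ (∀ y, ‖y‖ ≤ R → η y = 1) ∧
      (∀ y, ‖fderiv ℝ η y‖ ≤ C / R) ∧ (∀ y, ‖y‖ < R → fderiv ℝ η y = 0) ∧
      (∀ y, 2 * R < ‖y‖ → fderiv ℝ η y = 0) := by
  let ρ : ContDiffBump (0 : E) := ⟨1, 2, one_pos, one_lt_two⟩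
  have hρ : ContDiff ℝ 1 ρ := ρ.contDiff
  obtain ⟨C, hC⟩ := (ρ.hasCompactSupport.fderiv ℝ).exists_bound_of_continuous
    (hρ.continuous_fderiv one_ne_zero)
  refine ⟨C, (norm_nonneg _).trans (hC 0), fun R hR => ?_⟩
  have hn : ∀ y : E, ‖R⁻¹ • y‖ = ‖y‖ / R := fun y => by
    rw [norm_smul, norm_inv, Real.norm_of_nonneg hR.le, inv_mul_eq_div]
  have h1 : ∀ y : E, ‖y‖ ≤ R → ρ (R⁻¹ • y) = 1 := fun y hy =>
    ρ.one_of_mem_closedBall <| by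
      rw [mem_closedBall_zero_iff, hn]
      exact (div_le_one hR).2 hy
  have h2 : ∀ y : E, 2 * R ≤ ‖y‖ → ρ (R⁻¹ • y) = 0 := fun y hy =>
    ρ.zero_of_le_dist <| by
      rw [dist_zero_right, hn]
      exact (le_div_iff₀ hR).2 hy
  refine ⟨fun y => ρ (R⁻¹ • y), hρ.comp (contDiff_const_smul _), ?_, fun y => ρ.nonneg,
    fun y => ρ.le_one, h1, fun y => ?_, fun y hy => ?_, fun y hy => ?_⟩
  · have : ProperSpace E := FiniteDimensional.proper ℝ E
    refine HasCompactSupport.intro (isCompact_closedBall (0 : E) (2 * R)) fun y hy => h2 y ?_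
    rw [mem_closedBall_zero_iff, not_le] at hy
    exact hy.le
  · rw [fderiv_comp_smul, norm_smul, norm_inv, Real.norm_of_nonneg hR.le, inv_mul_eq_div]
    exact div_le_div_of_nonneg_right (hC _) hR.le
  · have : (fun y => ρ (R⁻¹ • y)) =ᶠ[𝓝 y] fun _ => (1 : ℝ) := by
      filter_upwards [(isOpen_lt continuous_norm continuous_const).mem_nhds hy] with z hz
      exact h1 z (le_of_lt hz)
    rw [this.fderiv_eq, fderiv_const_apply]
  · have : (fun y => ρ (R⁻¹ • y)) =ᶠ[𝓝 y] fun _ => (0 : ℝ) := by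
      filter_upwards [(isOpen_lt continuous_const continuous_norm).mem_nhds hy] with z hz
      exact h2 z (le_of_lt hz)
    rw [this.fderiv_eq, fderiv_const_apply]

lemma norm_smul_add_smul_dual_sq {E : Type*} [NormedAddCommGroup E] [InnerProductSpace ℝ E]
    [CompleteSpace E] (a b : ℝ) (L M : E →L[ℝ] ℝ) :
    ‖a • L + b • M‖ ^ 2 = a ^ 2 * ‖L‖ ^ 2 + 2 * (a * b) * L ((InnerProductSpace.toDual ℝ E).symm M)
      + b ^ 2 * M ((InnerProductSpace.toDual ℝ E).symm M) := by
  have h : ∀ T : E →L[ℝ] ℝ, ‖(InnerProductSpace.toDual ℝ E).symm T‖ = ‖T‖ :=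
    fun T => LinearIsometryEquiv.norm_map _ T
  rw [← h (a • L + b • M), ← h L, ← InnerProductSpace.toDual_symm_apply (y := L),
    ← InnerProductSpace.toDual_symm_apply (y := M), real_inner_self_eq_norm_sq, map_add,
    norm_add_sq_real]
  simp only [map_smulₛₗ, norm_smul, inner_smul_left, inner_smul_right, mul_pow, Real.norm_eq_abs,
    sq_abs, conj_trivial]
  ring

lemma integrable_restrict_mul_of_isCompact {E : Type*} [TopologicalSpace E] [T2Space E]
    [MeasurableSpace E] [OpensMeasurableSpace E] {μ : Measure E} {Ω K : Set E} (hΩ : MeasurableSet Ω)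
    {g h : E → ℝ} (hg : LocallyIntegrable g (μ.restrict Ω)) (hK : IsCompact K)
    (hh : ContinuousOn h K) (h0 : ∀ y ∈ Ω, y ∉ K → h y = 0) :
    Integrable (fun y => g y * h y) (μ.restrict Ω) := by
  rw [← integrableOn_univ]
  refine ((hg.integrableOn_isCompact hK).mul_continuousOn hh hK).of_ae_sdiff_eq_zero
    nullMeasurableSet_univ ?_
  filter_upwards [ae_restrict_mem hΩ] with y hy hyK
  rw [h0 y hy hyK.2, mul_zero]

/-- Caccioppoli type estimate for a weak subsolution of `-Δ w = φ w` that is nonpositive on the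
boundary: the energy of a truncation of `w⁺ η` is controlled up to an error linear in the
truncation parameter. -/
lemma exists_truncation_energy_le {E : Type*} [NormedAddCommGroup E] [InnerProductSpace ℝ E]
    [FiniteDimensional ℝ E] [CompleteSpace E] [MeasurableSpace E] [BorelSpace E] {Ω : Set E}
    (hΩ : IsOpen Ω) {w φ η : E → ℝ} (hwc : ContinuousOn w (closure Ω)) (hwd : ContDiffOn ℝ 1 w Ω)
    (hbd : ∀ y ∈ frontier Ω, w y ≤ 0) (hφ : LocallyIntegrable φ (volume.restrict Ω))
    (hweak : ∀ ξ : E → ℝ, ContDiff ℝ (⊤ : ℕ∞) ξ → HasCompactSupport ξ → tsupport ξ ⊆ Ω →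
      (∀ y, 0 ≤ ξ y) →
      ∫ y in Ω, fderiv ℝ ξ y (gradient w y) ≤ ∫ y in Ω, φ y * w y * ξ y)
    (hη : ContDiff ℝ 1 η) (hηc : HasCompactSupport η) (hη0 : ∀ y, 0 ≤ η y) (hη1 : ∀ y, η y ≤ 1)
    {δ : ℝ} (hδ : 0 < δ) :
    ∃ u : E → ℝ, ContDiff ℝ 1 u ∧ HasCompactSupport u ∧ (∀ y ∉ Ω, u y = 0) ∧
      (∀ y ∈ Ω, (w y - 2 * δ) * η y ≤ u y) ∧
      ∫ y, ‖fderiv ℝ u y‖ ^ 2 ≤ (∫ y in Ω, |φ y| * u y ^ 2) +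
        2 * δ * (∫ y in Ω, |φ y| * (max (w y) 0 * η y)) +
        ∫ y in Ω, max (w y) 0 ^ 2 * ‖fderiv ℝ η y‖ ^ 2 := by
  obtain ⟨F, F', F'', hF, hF', hF''c, hFz, hF0, hFle, hFge, hF'0, hF'1, hF''0⟩ :=
    exists_smooth_convex_truncation hδ
  have hF'c : Continuous F' := continuous_iff_continuousAt.2 fun t => (hF' t).continuousAt
  have hFC : ContDiff ℝ 1 F := contDiff_one_iff_deriv.2
    ⟨fun t => (hF t).differentiableAt, by rwa [funext fun t => (hF t).deriv]⟩
  have hF'C : ContDiff ℝ 1 F' := contDiff_one_iff_deriv.2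
    ⟨fun t => (hF' t).differentiableAt, by rwa [funext fun t => (hF' t).deriv]⟩
  let K : Set E := (closure Ω ∩ w ⁻¹' Ici δ) ∩ tsupport η
  have hKcl : IsClosed (closure Ω ∩ w ⁻¹' Ici δ) :=
    hwc.preimage_isClosed_of_isClosed isClosed_closure isClosed_Ici
  have hK : IsCompact K := hηc.isCompact.inter_left hKcl
  have hKΩ : K ⊆ Ω := fun y hy => by
    by_contra hyΩ
    have : y ∈ frontier Ω := by rw [hΩ.frontier_eq]; exact ⟨hy.1.1, hyΩ⟩
    have hyδ : δ ≤ w y := hy.1.2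
    linarith [hbd y this]
  have hKF : ∀ y ∈ Ω, y ∉ K → F (w y) = 0 ∨ y ∉ tsupport η := fun y hy hyK => by
    by_contra! h
    refine hyK ⟨⟨subset_closure hy, ?_⟩, h.2⟩
    by_contra hlt
    exact h.1 (hFz _ (le_of_lt (not_le.1 hlt)))
  let u₀ : E → ℝ := fun y => F (w y) * η y
  let ξ₀ : E → ℝ := fun y => F (w y) * F' (w y) * η y ^ 2
  have hu₀ : ∀ y ∈ Ω, y ∉ K → u₀ y = 0 := fun y hy hyK => by
    rcases hKF y hy hyK with h | h
    · simp [u₀, h]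
    · simp [u₀, image_eq_zero_of_notMem_tsupport h]
  have hξ₀ : ∀ y ∈ Ω, y ∉ K → ξ₀ y = 0 := fun y hy hyK => by
    rcases hKF y hy hyK with h | h
    · simp [ξ₀, h]
    · simp [ξ₀, image_eq_zero_of_notMem_tsupport h]
  obtain ⟨huC, hus⟩ := contDiff_indicator_of_isClosed hΩ hK.isClosed hKΩ
    (f := u₀) (n := 1) ((hFC.comp_contDiffOn hwd).mul hη.contDiffOn) hu₀
  obtain ⟨hξC, hξs⟩ := contDiff_indicator_of_isClosed hΩ hK.isClosed hKΩ
    (f := ξ₀) (n := 1) (((hFC.comp_contDiffOn hwd).mul (hF'C.comp_contDiffOn hwd)).mul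
      (hη.contDiffOn.pow 2)) hξ₀
  set u := Ω.indicator u₀ with hu
  set ξ := Ω.indicator ξ₀ with hξ
  have huc : HasCompactSupport u := hK.of_isClosed_subset (isClosed_tsupport _) hus
  have hξc : HasCompactSupport ξ := hK.of_isClosed_subset (isClosed_tsupport _) hξs
  have hξ0 : ∀ y, 0 ≤ ξ y := fun y => indicator_nonneg
    (fun y _ => mul_nonneg (mul_nonneg (hF0 _) (hF'0 _)) (sq_nonneg _)) y
  have hwdf : ContinuousOn (fderiv ℝ w) Ω := hwd.continuousOn_fderiv_of_isOpen hΩ le_rfl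
  have hgrad : ContinuousOn (gradient w) Ω :=
    (InnerProductSpace.toDual ℝ E).symm.continuous.comp_continuousOn hwdf
  have hweak' : ∫ y in Ω, fderiv ℝ ξ y (gradient w y) ≤ ∫ y in Ω, φ y * w y * ξ y :=
    weak_ineq_of_contDiff_one hΩ hgrad
      ((locallyIntegrableOn_of_locallyIntegrable_restrict hφ).mul_continuousOn
        (hwc.mono subset_closure) hΩ.isLocallyClosed) hweak hξC hξc (hξs.trans hKΩ) hξ0
  have hpt : ∀ y ∈ Ω, ‖fderiv ℝ u y‖ ^ 2 ≤
      fderiv ℝ ξ y (gradient w y) + F (w y) ^ 2 * ‖fderiv ℝ η y‖ ^ 2 := fun y hy => by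
    have hwy : HasFDerivAt w (fderiv ℝ w y) y :=
      ((hwd.contDiffAt (hΩ.mem_nhds hy)).differentiableAt one_ne_zero).hasFDerivAt
    have hηy : HasFDerivAt η (fderiv ℝ η y) y :=
      (hη.differentiable one_ne_zero y).hasFDerivAt
    have hFy := (hF (w y)).comp_hasFDerivAt y hwy
    have hF'y := (hF' (w y)).comp_hasFDerivAt y hwy
    have e1 : u =ᶠ[𝓝 y] u₀ := by
      filter_upwards [hΩ.mem_nhds hy] with z hz using indicator_of_mem hz _
    have e2 : ξ =ᶠ[𝓝 y] ξ₀ := by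
      filter_upwards [hΩ.mem_nhds hy] with z hz using indicator_of_mem hz _
    have d1 : fderiv ℝ u y = F (w y) • fderiv ℝ η y + (η y * F' (w y)) • fderiv ℝ w y := by
      rw [mul_smul]
      exact e1.fderiv_eq.trans (hFy.mul hηy).fderiv
    have d2 := ((hFy.mul hF'y).mul (hηy.pow 2)).fderiv
    have hn : fderiv ℝ w y (gradient w y) = ‖gradient w y‖ ^ 2 := by
      rw [← real_inner_self_eq_norm_sq]
      exact InnerProductSpace.toDual_symm_apply.symm
    have d3 : fderiv ℝ ξ y (gradient w y) =
        (F' (w y) ^ 2 + F (w y) * F'' (w y)) * η y ^ 2 * ‖gradient w y‖ ^ 2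
        + 2 * (F (w y) * F' (w y) * η y) * fderiv ℝ η y (gradient w y) := by
      rw [e2.fderiv_eq]
      refine (congrArg (fun L : E →L[ℝ] ℝ => L (gradient w y)) d2).trans ?_
      simp [hn]
      ring
    rw [d1, norm_smul_add_smul_dual_sq, d3]
    have hg : (InnerProductSpace.toDual ℝ E).symm (fderiv ℝ w y) = gradient w y := rfl
    rw [hg, hn]
    have : 0 ≤ F (w y) * F'' (w y) * η y ^ 2 * ‖gradient w y‖ ^ 2 :=
      mul_nonneg (mul_nonneg (mul_nonneg (hF0 _) (hF''0 _)) (sq_nonneg _)) (sq_nonneg _)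
    linarith
  have hone : LocallyIntegrable (fun _ : E => (1 : ℝ)) (volume.restrict Ω) :=
    locallyIntegrable_const _
  have hdξ0 : ∀ y ∉ K, fderiv ℝ ξ y = 0 := fun y hy =>
    image_eq_zero_of_notMem_tsupport fun h => hy (hξs (tsupport_fderiv_subset ℝ h))
  have hdηz : ∀ y ∉ tsupport η, fderiv ℝ η y = 0 := fun y hy =>
    image_eq_zero_of_notMem_tsupport fun h => hy (tsupport_fderiv_subset ℝ h)
  have hK2 : IsCompact (closure Ω ∩ tsupport η) := hηc.isCompact.inter_left isClosed_closure
  have hK2n : ∀ y ∈ Ω, y ∉ closure Ω ∩ tsupport η → y ∉ tsupport η := fun y hy h h' =>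
    h ⟨subset_closure hy, h'⟩
  have hwK2 : ContinuousOn w (closure Ω ∩ tsupport η) := hwc.mono inter_subset_left
  have hwm : ContinuousOn (fun y => max (w y) 0) (closure Ω ∩ tsupport η) :=
    (continuous_id.max continuous_const).comp_continuousOn hwK2
  have hφa : LocallyIntegrable (fun y => |φ y|) (volume.restrict Ω) := fun x =>
    let ⟨s, hs, h⟩ := hφ x
    ⟨s, hs, h.norm⟩
  have hdηc : Continuous (fderiv ℝ η) := hη.continuous_fderiv one_ne_zero
  have i1 : IntegrableOn (fun y => ‖fderiv ℝ u y‖ ^ 2) Ω := by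
    refine Integrable.integrableOn (Continuous.integrable_of_hasCompactSupport
      ((huC.continuous_fderiv one_ne_zero).norm.pow 2) ?_)
    exact (huc.fderiv ℝ).comp_left (g := fun L => ‖L‖ ^ 2) (by simp)
  have i2 : IntegrableOn (fun y => fderiv ℝ ξ y (gradient w y)) Ω := by
    have := integrable_restrict_mul_of_isCompact hΩ.measurableSet hone hK
      (h := fun y => fderiv ℝ ξ y (gradient w y))
      ((hξC.continuous_fderiv one_ne_zero).continuousOn.clm_apply (hgrad.mono hKΩ))
      (fun y _ hy => by simp [hdξ0 y hy])
    simpa [IntegrableOn] using this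
  have i3 : IntegrableOn (fun y => F (w y) ^ 2 * ‖fderiv ℝ η y‖ ^ 2) Ω := by
    have := integrable_restrict_mul_of_isCompact hΩ.measurableSet hone hK2
      (h := fun y => F (w y) ^ 2 * ‖fderiv ℝ η y‖ ^ 2)
      (((hFC.continuous.comp_continuousOn hwK2).pow 2).mul (hdηc.norm.pow 2).continuousOn)
      (fun y hy h => by simp [hdηz y (hK2n y hy h)])
    simpa [IntegrableOn] using this
  have i4 : IntegrableOn (fun y => max (w y) 0 ^ 2 * ‖fderiv ℝ η y‖ ^ 2) Ω := by
    have := integrable_restrict_mul_of_isCompact hΩ.measurableSet hone hK2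
      (h := fun y => max (w y) 0 ^ 2 * ‖fderiv ℝ η y‖ ^ 2)
      ((hwm.pow 2).mul (hdηc.norm.pow 2).continuousOn)
      (fun y hy h => by simp [hdηz y (hK2n y hy h)])
    simpa [IntegrableOn] using this
  have i5 : IntegrableOn (fun y => |φ y| * u y ^ 2) Ω :=
    integrable_restrict_mul_of_isCompact hΩ.measurableSet hφa hK
      (huC.continuous.pow 2).continuousOn (fun y hy h => by
        rw [hu, indicator_of_mem hy, hu₀ y hy h, zero_pow two_ne_zero])
  have i6 : IntegrableOn (fun y => |φ y| * (max (w y) 0 * η y)) Ω :=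
    integrable_restrict_mul_of_isCompact hΩ.measurableSet hφa hK2
      (hwm.mul hη.continuous.continuousOn) (fun y hy h => by
        rw [image_eq_zero_of_notMem_tsupport (hK2n y hy h), mul_zero])
  have i7 : IntegrableOn (fun y => φ y * w y * ξ y) Ω := by
    simp_rw [mul_assoc]
    exact integrable_restrict_mul_of_isCompact hΩ.measurableSet hφ hK
      ((hwc.mono (hKΩ.trans subset_closure)).mul hξC.continuous.continuousOn) (fun y hy h => by
        rw [hξ, indicator_of_mem hy, hξ₀ y hy h, mul_zero])
  refine ⟨u, huC, huc, fun y hy => indicator_of_notMem hy _, fun y hy => ?_, ?_⟩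
  · rw [hu, indicator_of_mem hy]
    exact mul_le_mul_of_nonneg_right (hFge _) (hη0 y)
  have hφξ : ∀ y ∈ Ω, φ y * w y * ξ y ≤
      |φ y| * u y ^ 2 + 2 * δ * (|φ y| * (max (w y) 0 * η y)) := fun y hy => by
    have hux : u y = F (w y) * η y := indicator_of_mem hy _
    have hξx : ξ y = F (w y) * F' (w y) * η y ^ 2 := indicator_of_mem hy _
    rw [hux, hξx]
    have hm : 0 ≤ max (w y) 0 := le_max_right _ _
    rcases le_total (w y) δ with hwy | hwy
    · rw [hFz _ hwy]
      have := mul_nonneg (abs_nonneg (φ y)) (mul_nonneg hm (hη0 y))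
      simp only [mul_zero, zero_mul, zero_pow two_ne_zero, zero_add]
      positivity
    · have hw0 : 0 < w y := hδ.trans_le hwy
      have hFm := hFle (w y)
      rw [max_eq_left hw0.le] at hFm ⊢
      have h1 : w y * (F (w y) * F' (w y) * η y ^ 2) ≤ w y * F (w y) * η y ^ 2 := by
        have : 0 ≤ w y * F (w y) * η y ^ 2 := by have := hF0 (w y); positivity
        nlinarith [hF'1 (w y)]
      have h2 : w y * F (w y) * η y ^ 2 ≤ (F (w y) * η y) ^ 2 + 2 * δ * (w y * η y) := by
        have a1 : w y * F (w y) ≤ F (w y) ^ 2 + 2 * δ * w y := by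
          nlinarith [hFge (w y), hF0 (w y)]
        have a2 : η y ^ 2 ≤ η y := by nlinarith [hη0 y, hη1 y]
        have a3 := mul_le_mul_of_nonneg_right a1 (sq_nonneg (η y))
        have a4 := mul_le_mul_of_nonneg_left a2 (by positivity : 0 ≤ 2 * δ * w y)
        nlinarith
      have h0 : 0 ≤ w y * (F (w y) * F' (w y) * η y ^ 2) := by
        have := hF0 (w y); have := hF'0 (w y); positivity
      calc φ y * w y * (F (w y) * F' (w y) * η y ^ 2)
          = φ y * (w y * (F (w y) * F' (w y) * η y ^ 2)) := by ring
        _ ≤ |φ y| * (w y * (F (w y) * F' (w y) * η y ^ 2)) :=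
          mul_le_mul_of_nonneg_right (le_abs_self _) h0
        _ ≤ |φ y| * ((F (w y) * η y) ^ 2 + 2 * δ * (w y * η y)) :=
          mul_le_mul_of_nonneg_left (h1.trans h2) (abs_nonneg _)
        _ = _ := by ring
  have hFm : ∀ y ∈ Ω, F (w y) ^ 2 * ‖fderiv ℝ η y‖ ^ 2 ≤
      max (w y) 0 ^ 2 * ‖fderiv ℝ η y‖ ^ 2 := fun y _ =>
    mul_le_mul_of_nonneg_right (pow_le_pow_left₀ (hF0 _) (hFle _) 2) (sq_nonneg _)
  have hdu0 : ∀ y ∉ Ω, ‖fderiv ℝ u y‖ ^ 2 = 0 := fun y hy => by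
    rw [image_eq_zero_of_notMem_tsupport (f := fderiv ℝ u) fun h =>
      hy (hKΩ (hus (tsupport_fderiv_subset ℝ h)))]
    simp
  calc ∫ y, ‖fderiv ℝ u y‖ ^ 2 = ∫ y in Ω, ‖fderiv ℝ u y‖ ^ 2 :=
      (setIntegral_eq_integral_of_forall_compl_eq_zero hdu0).symm
    _ ≤ ∫ y in Ω, (fderiv ℝ ξ y (gradient w y) + F (w y) ^ 2 * ‖fderiv ℝ η y‖ ^ 2) :=
      setIntegral_mono_on i1 (i2.add i3) hΩ.measurableSet hpt
    _ = (∫ y in Ω, fderiv ℝ ξ y (gradient w y)) +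
        ∫ y in Ω, F (w y) ^ 2 * ‖fderiv ℝ η y‖ ^ 2 := integral_add i2 i3
    _ ≤ (∫ y in Ω, (|φ y| * u y ^ 2 + 2 * δ * (|φ y| * (max (w y) 0 * η y)))) +
        ∫ y in Ω, max (w y) 0 ^ 2 * ‖fderiv ℝ η y‖ ^ 2 :=
      add_le_add (hweak'.trans
        (setIntegral_mono_on i7 (i5.add (i6.const_mul _)) hΩ.measurableSet hφξ))
        (setIntegral_mono_on i3 i4 hΩ.measurableSet hFm)
    _ = _ := by rw [integral_add i5 (i6.const_mul _), integral_const_mul]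

/-- Hölder's inequality for `∫ |f| u²`. -/
lemma integral_abs_mul_sq_le {α : Type*} [MeasurableSpace α] {μ : Measure α} {p q : ℝ}
    (hpq : q.HolderConjugate (p / 2)) {f u : α → ℝ} (hf : MemLp f (ENNReal.ofReal q) μ)
    (hu : MemLp u (ENNReal.ofReal p) μ) :
    ∫ y, |f y| * u y ^ 2 ∂μ ≤ (∫ y, |f y| ^ q ∂μ) ^ (1 / q) * (∫ y, |u y| ^ p ∂μ) ^ (2 / p) := by
  have hu2 : MemLp (fun y => u y ^ 2) (ENNReal.ofReal (p / 2)) μ := by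
    have := hu.norm_rpow_div 2
    rw [ENNReal.ofReal_div_of_pos two_pos]
    simpa using this
  have h := integral_mul_le_Lp_mul_Lq_of_nonneg hpq (ae_of_all _ fun y => abs_nonneg (f y))
    (ae_of_all _ fun y => sq_nonneg (u y)) hf.norm hu2
  have he : ∀ y, (u y ^ 2) ^ (p / 2) = |u y| ^ p := fun y => by
    rw [← sq_abs, ← Real.rpow_natCast, ← Real.rpow_mul (abs_nonneg _)]
    congr 1
    push_cast
    ring
  simp only [he, one_div_div] at h
  exact h

/-- The scale invariant bound on the `L^N` norm of the gradient of a cutoff function. -/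
lemma integral_norm_fderiv_sq_rpow_le {E : Type*} [NormedAddCommGroup E] [InnerProductSpace ℝ E]
    [FiniteDimensional ℝ E] [MeasurableSpace E] [BorelSpace E] {C R : ℝ} (hR : 0 < R) {η : E → ℝ}
    (hN : Module.finrank ℝ E ≠ 0)
    (hb : ∀ y, ‖fderiv ℝ η y‖ ≤ C / R) (hz : ∀ y, 2 * R < ‖y‖ → fderiv ℝ η y = 0) :
    ∫ y, |‖fderiv ℝ η y‖ ^ 2| ^ ((Module.finrank ℝ E : ℝ) / 2) ≤
      (2 * C) ^ Module.finrank ℝ E * volume.real (ball (0 : E) 1) := by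
  set N := Module.finrank ℝ E
  have he : ∀ y, |‖fderiv ℝ η y‖ ^ 2| ^ ((N : ℝ) / 2) = ‖fderiv ℝ η y‖ ^ N := fun y => by
    rw [abs_of_nonneg (sq_nonneg _), ← Real.rpow_natCast, ← Real.rpow_mul (norm_nonneg _),
      ← Real.rpow_natCast]
    congr 1
    push_cast
    ring
  simp only [he]
  have hfin : volume (closedBall (0 : E) (2 * R)) ≠ ∞ := measure_closedBall_lt_top.ne
  calc ∫ y, ‖fderiv ℝ η y‖ ^ N
      ≤ ∫ y, (closedBall (0 : E) (2 * R)).indicator (fun _ => (C / R) ^ N) y := by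
        refine integral_mono_of_nonneg (ae_of_all _ fun y => by positivity)
          ((integrableOn_const hfin).integrable_indicator measurableSet_closedBall)
          (ae_of_all _ fun y => ?_)
        by_cases hy : y ∈ closedBall (0 : E) (2 * R)
        · simp only [indicator_of_mem hy]
          exact pow_le_pow_left₀ (norm_nonneg _) (hb y) N
        · rw [mem_closedBall_zero_iff, not_le] at hy
          simp [hz y hy, hN, hy]
    _ = (2 * C) ^ N * volume.real (ball (0 : E) 1) := by
        rw [integral_indicator measurableSet_closedBall, setIntegral_const, measureReal_def,
          Measure.addHaar_closedBall _ _ (by positivity), ENNReal.toReal_mul,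
          ENNReal.toReal_ofReal (by positivity), smul_eq_mul, measureReal_def]
        have : (2 * R) ^ N * (C / R) ^ N = (2 * C) ^ N := by
          rw [← mul_pow]
          congr 1
          field_simp
        rw [← this]
        ring

lemma tendsto_integral_abs_indicator_rpow_zero {E : Type*} [NormedAddCommGroup E]
    [MeasurableSpace E] [BorelSpace E] {μ : Measure E} {p : ℝ} (hp : 0 < p) {v : E → ℝ}
    (hv : MemLp v (ENNReal.ofReal p) μ) :
    Tendsto (fun n : ℕ => ∫ y, |{z : E | (n : ℝ) ≤ ‖z‖}.indicator v y| ^ p ∂μ) atTop (𝓝 0) := by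
  have hm : ∀ n : ℕ, MeasurableSet {z : E | (n : ℝ) ≤ ‖z‖} := fun n =>
    (isClosed_le continuous_const continuous_norm).measurableSet
  have hint : Integrable (fun y => |v y| ^ p) μ := by
    have := hv.integrable_norm_rpow (by simpa using hp) ENNReal.ofReal_ne_top
    simpa [ENNReal.toReal_ofReal hp.le] using this
  rw [← integral_zero E ℝ (μ := μ)]
  refine tendsto_integral_of_dominated_convergence (fun y => |v y| ^ p)
    (fun n => ?_) hint (fun n => ae_of_all _ fun y => ?_) (ae_of_all _ fun y => ?_)
  · exact ((hv.1.indicator (hm n)).aemeasurable.abs.pow_const p).aestronglyMeasurable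
  · rw [Real.norm_of_nonneg (by positivity)]
    refine Real.rpow_le_rpow (abs_nonneg _) ?_ hp.le
    exact norm_indicator_le_norm_self v y
  · obtain ⟨n₀, hn₀⟩ := exists_nat_gt ‖y‖
    refine tendsto_const_nhds.congr' ?_
    filter_upwards [eventually_ge_atTop n₀] with n hn
    have : y ∉ {z : E | (n : ℝ) ≤ ‖z‖} := fun h => by
      have h' : (n : ℝ) ≤ ‖y‖ := h
      have : (n₀ : ℝ) ≤ n := by exact_mod_cast hn
      linarith
    rw [indicator_of_notMem this, abs_zero, Real.zero_rpow hp.ne']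

/-- Comparison principle for a single function: a weak subsolution of `-Δ w = φ w` that is
nonpositive on the boundary and whose positive part is dominated by an `L^{2*}` function is
nonpositive, provided that the `L^{N/2}` norm of `φ` is below the Sobolev constant. -/
lemma nonpos_of_weak_subsolution {E : Type*} [NormedAddCommGroup E] [InnerProductSpace ℝ E]
    [FiniteDimensional ℝ E] [CompleteSpace E] [MeasurableSpace E] [BorelSpace E]
    {N : ℕ} (hNE : Module.finrank ℝ E = N) (hN : 3 ≤ N) {p : ℝ} (hp : p = 2 * N / ((N : ℝ) - 2))
    {S : ℝ} (hS : 0 < S)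
    (hSob : ∀ u : E → ℝ, ContDiff ℝ (⊤ : ℕ∞) u → HasCompactSupport u →
      S * (∫ y, |u y| ^ p) ^ (2 / p) ≤ ∫ y, ‖fderiv ℝ u y‖ ^ 2)
    {Ω : Set E} (hΩ : IsOpen Ω) {φ w v : E → ℝ}
    (hφmem : MemLp φ (ENNReal.ofReal ((N : ℝ) / 2)) (volume.restrict Ω))
    (hφnorm : eLpNorm φ (ENNReal.ofReal ((N : ℝ) / 2)) (volume.restrict Ω) < ENNReal.ofReal S)
    (hwc : ContinuousOn w (closure Ω)) (hwd : ContDiffOn ℝ 1 w Ω)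
    (hbd : ∀ y ∈ frontier Ω, w y ≤ 0) (hv : MemLp v (ENNReal.ofReal p) (volume.restrict Ω))
    (hwv : ∀ y ∈ Ω, max (w y) 0 ≤ |v y|)
    (hweak : ∀ ξ : E → ℝ, ContDiff ℝ (⊤ : ℕ∞) ξ → HasCompactSupport ξ → tsupport ξ ⊆ Ω →
      (∀ y, 0 ≤ ξ y) →
      ∫ y in Ω, fderiv ℝ ξ y (gradient w y) ≤ ∫ y in Ω, φ y * w y * ξ y) :
    ∀ y ∈ Ω, w y ≤ 0 := by
  have hN3 : (3 : ℝ) ≤ N := by exact_mod_cast hN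
  have hN2 : (0 : ℝ) < (N : ℝ) - 2 := by linarith
  have hp0 : 0 < p := by rw [hp]; positivity
  have hpq : ((N : ℝ) / 2).HolderConjugate (p / 2) := by
    rw [Real.holderConjugate_iff, hp]
    refine ⟨by linarith, ?_⟩
    have : (N : ℝ) ≠ 0 := by linarith
    field_simp
    ring
  have hq0 : (0 : ℝ) < (N : ℝ) / 2 := by linarith
  set q : ℝ := (N : ℝ) / 2 with hq
  set Φ : ℝ := (∫ y in Ω, |φ y| ^ q) ^ (1 / q) with hΦ
  have hΦS : Φ < S := by
    rw [hφmem.eLpNorm_eq_integral_rpow_norm (by simpa using hq0) ENNReal.ofReal_ne_top,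
      ENNReal.ofReal_lt_ofReal_iff hS, ENNReal.toReal_ofReal hq0.le, ← one_div] at hφnorm
    exact hφnorm
  have hφl : LocallyIntegrable φ (volume.restrict Ω) :=
    hφmem.locallyIntegrable (by
      rw [← ENNReal.ofReal_one]
      exact ENNReal.ofReal_le_ofReal (by rw [hq]; linarith))
  obtain ⟨C, hC0, hC⟩ := exists_cutoff E
  set B : ℝ := ((2 * C) ^ N * volume.real (ball (0 : E) 1)) ^ (1 / q) with hB
  set T : ℕ → ℝ := fun n =>
    (∫ y in Ω, |{z : E | (n : ℝ) ≤ ‖z‖}.indicator v y| ^ p) ^ (2 / p) with hT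
  have hTlim : Tendsto T atTop (𝓝 0) := by
    have := (tendsto_integral_abs_indicator_rpow_zero hp0 hv).rpow_const
      (p := 2 / p) (Or.inr (by positivity))
    rwa [Real.zero_rpow (by positivity)] at this
  by_contra! hcon
  obtain ⟨x₀, hx₀, hw₀⟩ := hcon
  set m : ℝ := w x₀ / 2 with hm
  have hm0 : 0 < m := half_pos hw₀
  have hnhds : {y | m < w y} ∩ Ω ∈ 𝓝 x₀ := by
    refine inter_mem ?_ (hΩ.mem_nhds hx₀)
    exact ((hwd.continuousOn.continuousAt (hΩ.mem_nhds hx₀))).eventually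
      (lt_mem_nhds (half_lt_self hw₀))
  obtain ⟨r, hr, hrs⟩ := Metric.mem_nhds_iff.1 hnhds
  set c : ℝ := (S - Φ) * ((m / 2) ^ p * volume.real (ball x₀ r)) ^ (2 / p) with hc
  have hvol : 0 < volume.real (ball x₀ r) :=
    ENNReal.toReal_pos (measure_ball_pos _ _ hr).ne' measure_ball_lt_top.ne
  have hc0 : 0 < c := mul_pos (sub_pos.2 hΦS) (by positivity)
  have key : ∀ n : ℕ, 0 < n → ‖x₀‖ + r ≤ n → c ≤ B * T n := fun n hn hnr => by
    have hn' : (0 : ℝ) < n := by exact_mod_cast hn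
    obtain ⟨η, hη, hηc, hη0, hη1, hηone, hηb, hηz, hηz'⟩ := hC n hn'
    set A : ℝ := ∫ y in Ω, |φ y| * (max (w y) 0 * η y) with hA
    have hdη : MemLp (fun y => ‖fderiv ℝ η y‖ ^ 2) (ENNReal.ofReal q) volume :=
      Continuous.memLp_of_hasCompactSupport ((hη.continuous_fderiv one_ne_zero).norm.pow 2)
        ((hηc.fderiv ℝ).comp_left (g := fun L => ‖L‖ ^ 2) (by simp))
    have hset : MeasurableSet {z : E | (n : ℝ) ≤ ‖z‖} :=
      (isClosed_le continuous_const continuous_norm).measurableSet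
    have hvn : MemLp ({z : E | (n : ℝ) ≤ ‖z‖}.indicator v) (ENNReal.ofReal p)
        (volume.restrict Ω) := hv.indicator hset
    have htail : ∫ y in Ω, max (w y) 0 ^ 2 * ‖fderiv ℝ η y‖ ^ 2 ≤ B * T n := by
      calc ∫ y in Ω, max (w y) 0 ^ 2 * ‖fderiv ℝ η y‖ ^ 2
          ≤ ∫ y in Ω, |‖fderiv ℝ η y‖ ^ 2| * {z : E | (n : ℝ) ≤ ‖z‖}.indicator v y ^ 2 := by
            refine integral_mono_of_nonneg (ae_of_all _ fun y => by positivity) ?_ ?_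
            · have := hpq.ennrealOfReal
              have h2 : MemLp (fun y => {z : E | (n : ℝ) ≤ ‖z‖}.indicator v y ^ 2)
                  (ENNReal.ofReal (p / 2)) (volume.restrict Ω) := by
                have := hvn.norm_rpow_div 2
                rw [ENNReal.ofReal_div_of_pos two_pos]
                simpa using this
              exact (hdη.restrict Ω).norm.integrable_mul h2
            · filter_upwards [ae_restrict_mem hΩ.measurableSet] with y hy
              rw [abs_of_nonneg (sq_nonneg _)]
              by_cases hyn : ‖y‖ < n
              · simp [hηz y hyn]
              · rw [indicator_of_mem (s := {z : E | (n : ℝ) ≤ ‖z‖}) (not_lt.1 hyn), mul_comm,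
                  ← sq_abs (v y)]
                exact mul_le_mul_of_nonneg_left
                  (pow_le_pow_left₀ (le_max_right _ _) (hwv y hy) 2) (sq_nonneg _)
        _ ≤ (∫ y in Ω, |‖fderiv ℝ η y‖ ^ 2| ^ q) ^ (1 / q) * T n :=
            integral_abs_mul_sq_le hpq (hdη.restrict Ω) hvn
        _ ≤ B * T n := by
            refine mul_le_mul_of_nonneg_right (Real.rpow_le_rpow
              (integral_nonneg fun y => by positivity) ?_ (by positivity))
              (Real.rpow_nonneg (integral_nonneg fun y => by positivity) _)
            have hint : Integrable (fun y => |‖fderiv ℝ η y‖ ^ 2| ^ q) volume := by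
              have := hdη.integrable_norm_rpow (by simpa using hq0) ENNReal.ofReal_ne_top
              simpa [ENNReal.toReal_ofReal hq0.le] using this
            refine (setIntegral_le_integral hint (ae_of_all _ fun y => by positivity)).trans ?_
            have := integral_norm_fderiv_sq_rpow_le hn' (by omega) hηb hηz'
            rwa [hNE] at this
    have hsmall : ∀ δ : ℝ, 0 < δ → δ ≤ m / 4 → c ≤ 2 * δ * A + B * T n := fun δ hδ hδm => by
      obtain ⟨u, huC, huc, huz, hul, hue⟩ := exists_truncation_energy_le hΩ hwc hwd hbd hφl hweak
        hη hηc hη0 hη1 hδ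
      have hsob := sobolev_of_contDiff_one hp0 hSob huC huc
      have huLp : MemLp u (ENNReal.ofReal p) volume :=
        huC.continuous.memLp_of_hasCompactSupport huc
      have hhol := integral_abs_mul_sq_le hpq hφmem (huLp.restrict Ω)
      rw [← hΦ, setIntegral_eq_integral_of_forall_compl_eq_zero (s := Ω)
        (f := fun y => |u y| ^ p) fun y hy => by
          rw [huz y hy, abs_zero, Real.zero_rpow hp0.ne']] at hhol
      have hupi : Integrable (fun y => |u y| ^ p) volume := by
        have := huLp.integrable_norm_rpow (by simpa using hp0) ENNReal.ofReal_ne_top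
        simpa [ENNReal.toReal_ofReal hp0.le] using this
      have hlow : (m / 2) ^ p * volume.real (ball x₀ r) ≤ ∫ y, |u y| ^ p := by
        calc (m / 2) ^ p * volume.real (ball x₀ r)
            = ∫ _ in ball x₀ r, (m / 2) ^ p := by
              rw [setIntegral_const, smul_eq_mul, mul_comm]
          _ ≤ ∫ y in ball x₀ r, |u y| ^ p := by
              refine setIntegral_mono_on (integrableOn_const measure_ball_lt_top.ne)
                hupi.integrableOn measurableSet_ball fun y hy => ?_
              obtain ⟨h1, h2⟩ := hrs hy
              have h1 : m < w y := h1
              have hyn : ‖y‖ ≤ n := by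
                have := norm_le_norm_add_norm_sub x₀ y
                rw [mem_ball, dist_eq_norm] at hy
                rw [norm_sub_rev] at this
                linarith
              have h3 := hul y h2
              rw [hηone y hyn, mul_one] at h3
              refine Real.rpow_le_rpow (by positivity) ?_ hp0.le
              exact le_trans (by linarith) (le_abs_self _)
          _ ≤ ∫ y, |u y| ^ p :=
              setIntegral_le_integral hupi (ae_of_all _ fun y => by positivity)
      have hmain : (S - Φ) * (∫ y, |u y| ^ p) ^ (2 / p) ≤ 2 * δ * A + B * T n := by
        rw [sub_mul]
        linarith
      exact (mul_le_mul_of_nonneg_left (Real.rpow_le_rpow (by positivity) hlow (by positivity))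
        (sub_pos.2 hΦS).le).trans hmain
    have hlim : Tendsto (fun δ : ℝ => 2 * δ * A + B * T n) (𝓝[>] 0) (𝓝 (B * T n)) := by
      have : Continuous fun δ : ℝ => 2 * δ * A + B * T n := by fun_prop
      simpa using (this.tendsto 0).mono_left nhdsWithin_le_nhds
    refine ge_of_tendsto hlim ?_
    filter_upwards [Ioc_mem_nhdsGT (by positivity : 0 < m / 4)] with δ hδ
    exact hsmall δ hδ.1 hδ.2
  have hle : c ≤ B * 0 := by
    refine ge_of_tendsto (hTlim.const_mul B) ?_
    obtain ⟨n₀, hn₀⟩ := exists_nat_ge (‖x₀‖ + r)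
    filter_upwards [eventually_ge_atTop n₀, eventually_gt_atTop 0] with n hn hn1
    exact key n hn1 (hn₀.trans (by exact_mod_cast hn))
  linarith

end

/-- Lemma 2.4 (comparison principle): if `‖φ‖_{L^{N/2}(Ω)} < S` (the Sobolev constant),
`v₁ ≥ 0` with locally square-integrable gradient, `v₂ ∈ D^{1,2}(Ω) ∩ L^{2*}(Ω)`,
`−Δ(v₂−v₁) − φ(v₂−v₁) ≤ 0` weakly in `Ω` and `v₂ ≤ v₁` on `∂Ω`, then `v₂ ≤ v₁` in `Ω`. -/
theorem comparison_principle
    (N : ℕ) (hN : 3 ≤ N)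
    (p : ℝ) (hp : p = 2 * N / ((N : ℝ) - 2))
    (S : ℝ) (hS : 0 < S)
    -- the Sobolev inequality with constant `S`
    (hSob : ∀ u : EuclideanSpace ℝ (Fin N) → ℝ,
      ContDiff ℝ (⊤ : ℕ∞) u → HasCompactSupport u →
      S * (∫ y, |u y| ^ p) ^ (2 / p) ≤ ∫ y, ‖gradient u y‖ ^ 2)
    (Ω : Set (EuclideanSpace ℝ (Fin N))) (hΩ : IsOpen Ω)
    (φ : EuclideanSpace ℝ (Fin N) → ℝ)
    (hφmem : MemLp φ (ENNReal.ofReal ((N : ℝ) / 2)) (volume.restrict Ω))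
    (hφnorm : eLpNorm φ (ENNReal.ofReal ((N : ℝ) / 2)) (volume.restrict Ω)
      < ENNReal.ofReal S)
    (v1 v2 : EuclideanSpace ℝ (Fin N) → ℝ)
    (hv1cont : ContinuousOn v1 (closure Ω)) (hv2cont : ContinuousOn v2 (closure Ω))
    (hv1diff : ContDiffOn ℝ 1 v1 Ω) (hv2diff : ContDiffOn ℝ 1 v2 Ω)
    (hv1nonneg : ∀ y ∈ Ω, 0 ≤ v1 y)
    -- `∇v₁` is square-integrable on every compact subset of `Ω`
    (hv1loc : ∀ Kc : Set (EuclideanSpace ℝ (Fin N)), IsCompact Kc → Kc ⊆ Ω →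
      IntegrableOn (fun y => ‖gradient v1 y‖ ^ 2) Kc volume)
    -- `v₂ ∈ L^{2*}(Ω)` and `∇v₂ ∈ L²(Ω)`
    (hv2Lp : MemLp v2 (ENNReal.ofReal p) (volume.restrict Ω))
    (hv2grad : IntegrableOn (fun y => ‖gradient v2 y‖ ^ 2) Ω volume)
    -- weak differential inequality `−Δ(v₂−v₁) − φ(v₂−v₁) ≤ 0` in `Ω`
    (hweak : ∀ ξ : EuclideanSpace ℝ (Fin N) → ℝ,
      ContDiff ℝ (⊤ : ℕ∞) ξ → HasCompactSupport ξ → tsupport ξ ⊆ Ω →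
      (∀ y, 0 ≤ ξ y) →
      (∫ y in Ω, (inner ℝ (gradient v2 y - gradient v1 y) (gradient ξ y) : ℝ)) ≤
        ∫ y in Ω, φ y * (v2 y - v1 y) * ξ y)
    -- boundary condition
    (hbd : ∀ y ∈ frontier Ω, v2 y ≤ v1 y) :
    ∀ y ∈ Ω, v2 y ≤ v1 y := by
  have hw : ∀ y ∈ Ω, v2 y - v1 y ≤ 0 := by
    refine nonpos_of_weak_subsolution (v := v2) finrank_euclideanSpace_fin hN hp hS
      (fun u hu hc => ?_) hΩ hφmem hφnorm (hv2cont.sub hv1cont) (hv2diff.sub hv1diff)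
      (fun y hy => sub_nonpos.2 (hbd y hy)) hv2Lp (fun y hy => ?_) (fun ξ hξ hc hs h0 => ?_)
    · simpa only [gradient, LinearIsometryEquiv.norm_map] using hSob u hu hc
    · exact max_le (by linarith [hv1nonneg y hy, le_abs_self (v2 y)]) (abs_nonneg _)
    · refine le_of_eq_of_le (setIntegral_congr_fun hΩ.measurableSet fun y hy => ?_)
        (hweak ξ hξ hc hs h0)
      have h1 := (hv1diff.contDiffAt (hΩ.mem_nhds hy)).differentiableAt one_ne_zero
      have h2 := (hv2diff.contDiffAt (hΩ.mem_nhds hy)).differentiableAt one_ne_zero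
      have hg : gradient (fun z => v2 z - v1 z) y = gradient v2 y - gradient v1 y := by
        simp only [gradient, fderiv_fun_sub h2 h1, map_sub]
      change fderiv ℝ ξ y (gradient (fun z => v2 z - v1 z) y) = _
      rw [hg, real_inner_comm]
      exact InnerProductSpace.toDual_symm_apply.symm
  exact fun y hy => sub_nonpos.1 (hw y hy)
end
end

section
/- Let N ≥ 5 be an integer, m ∈ [2, N−2), τ1 = (N−2−m)/(N−2), and r0 > 0. Then there exist a constant C > 0 and an integer k0 such that for every integer k ≥ k0, setting μ = k^{1/τ1}, for every r ∈ [r0 μ − 1, r0 μ + 1] and the k points x^i = r(cos(2(i−1)π/k), sin(2(i−1)π/k), 0, …, 0) ∈ ℝ² × ℝ^{N−2} (i = 1, …, k), one has: (i) Σ_{i=2}^k |x^i − x^1|^{−τ1} ≤ C; and (ii) for every y ∈ ℝ^N, Σ_{i=1}^k (1 + |y − x^i|)^{−τ1} ≤ C. -/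
noncomputable section

/-- The `i`-th of `k` equally spaced points on the circle of radius `r`
in the `(y₁,y₂)`-plane of `ℝ^N` (here `i = 1, …, k`). -/
noncomputable def circlePt (N k : ℕ) (r : ℝ) (i : ℕ) : EuclideanSpace ℝ (Fin N) :=
  WithLp.toLp 2 fun j : Fin N =>
    if (j : ℕ) = 0 then r * Real.cos (2 * Real.pi * ((i : ℝ) - 1) / k)
    else if (j : ℕ) = 1 then r * Real.sin (2 * Real.pi * ((i : ℝ) - 1) / k)
    else 0

/-- Twice the radius times the sine of half the angle bounds the distance of two circle points
from below. -/
lemma two_mul_sin_le_norm_circlePt_sub {N : ℕ} (hN : 2 ≤ N) (k : ℕ) (r : ℝ) (i j : ℕ) :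
    2 * r * Real.sin (Real.pi * ((i : ℝ) - j) / k) ≤ ‖circlePt N k r i - circlePt N k r j‖ := by
  rw [EuclideanSpace.norm_eq]
  apply Real.le_sqrt_of_sq_le
  have hne : (⟨0, by omega⟩ : Fin N) ≠ ⟨1, by omega⟩ := by simp
  refine le_trans (le_of_eq ?_) (Finset.sum_le_sum_of_subset_of_nonneg
    (Finset.subset_univ {(⟨0, by omega⟩ : Fin N), ⟨1, by omega⟩}) fun _ _ _ => sq_nonneg _)
  rw [Finset.sum_pair hne]
  simp only [circlePt, PiLp.sub_apply, Real.norm_eq_abs, sq_abs, if_true, one_ne_zero, if_false]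
  set a := 2 * Real.pi * ((i : ℝ) - 1) / k with ha
  set b := 2 * Real.pi * ((j : ℝ) - 1) / k with hb
  have hab : Real.pi * ((i : ℝ) - j) / k = (a - b) / 2 := by rw [ha, hb]; ring
  have hcos : Real.cos (a - b) = 1 - 2 * Real.sin ((a - b) / 2) ^ 2 := by
    have h := Real.cos_two_mul ((a - b) / 2)
    have h' := Real.sin_sq_add_cos_sq ((a - b) / 2)
    rw [mul_div_cancel₀ _ (two_ne_zero)] at h
    linarith
  rw [Real.cos_sub] at hcos
  rw [hab]
  linear_combination (2 * r ^ 2) * hcos - r ^ 2 * Real.sin_sq_add_cos_sq a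
    - r ^ 2 * Real.sin_sq_add_cos_sq b

/-- Lower bound of the distance of two circle points by their cyclic index distance. -/
lemma mul_min_le_norm_circlePt_sub {N : ℕ} (hN : 2 ≤ N) {k : ℕ} {r : ℝ} (hr : 0 ≤ r)
    {i j : ℕ} (hji : j < i) (hik : i < k + j) :
    4 * r / k * min ((i - j : ℕ) : ℝ) ((k + j - i : ℕ) : ℝ)
      ≤ ‖circlePt N k r i - circlePt N k r j‖ := by
  refine le_trans ?_ (two_mul_sin_le_norm_circlePt_sub hN k r i j)
  have hk : (0 : ℝ) < k := by
    have : 0 < k := by omega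
    exact_mod_cast this
  have hji' : (j : ℝ) < i := by exact_mod_cast hji
  have hik' : (i : ℝ) < k + j := by exact_mod_cast hik
  rw [Nat.cast_sub hji.le, Nat.cast_sub hik.le, Nat.cast_add]
  have key : 2 / (k : ℝ) * min ((i : ℝ) - j) (k + j - i)
      ≤ Real.sin (Real.pi * ((i : ℝ) - j) / k) := by
    rcases le_total ((i : ℝ) - j) (k + j - i) with h | h
    · rw [min_eq_left h]
      have := Real.mul_le_sin (x := Real.pi * ((i : ℝ) - j) / k)
        (by have := sub_pos.2 hji'; positivity)
        (by rw [div_le_div_iff₀ hk two_pos]; nlinarith [Real.pi_pos])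
      refine le_trans (le_of_eq ?_) this
      field_simp
    · rw [min_eq_right h, ← Real.sin_pi_sub]
      have hx : Real.pi - Real.pi * ((i : ℝ) - j) / k = Real.pi * ((k : ℝ) + j - i) / k := by
        field_simp
        ring
      rw [hx]
      have := Real.mul_le_sin (x := Real.pi * ((k : ℝ) + j - i) / k)
        (by have := sub_pos.2 hik'; positivity)
        (by rw [div_le_div_iff₀ hk two_pos]; nlinarith [Real.pi_pos])
      refine le_trans (le_of_eq ?_) this
      field_simp
  calc _ = 2 * r * (2 / (k : ℝ) * min ((i : ℝ) - j) (k + j - i)) := by ring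
    _ ≤ _ := by gcongr

lemma sum_Icc_rpow_neg_le {t : ℝ} (h0 : 0 < t) (h1 : t < 1) (n : ℕ) :
    ∑ d ∈ Finset.Icc 1 n, (d : ℝ) ^ (-t) ≤ (n : ℝ) ^ (1 - t) / (1 - t) := by
  have ht : 0 < 1 - t := by linarith
  induction n with
  | zero => simp [Real.zero_rpow ht.ne']
  | succ n ih =>
    rw [Finset.sum_Icc_succ_top (by omega)]
    have hx : (0 : ℝ) < (n + 1 : ℕ) := by positivity
    have hb := rpow_one_add_le_one_add_mul_self (s := -(1 / ((n + 1 : ℕ) : ℝ)))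
      (by rw [neg_le_neg_iff, div_le_one hx]; push_cast; linarith [Nat.cast_nonneg (α := ℝ) n])
      ht.le (by linarith : 1 - t ≤ 1)
    have hfac : (n : ℝ) = ((n + 1 : ℕ) : ℝ) * (1 + -(1 / ((n + 1 : ℕ) : ℝ))) := by
      field_simp
      push_cast
      ring
    have hnn : 0 ≤ 1 + -(1 / ((n + 1 : ℕ) : ℝ)) := by
      by_contra! hneg
      have := mul_neg_of_pos_of_neg hx hneg
      linarith [Nat.cast_nonneg (α := ℝ) n]
    have hpow : (n : ℝ) ^ (1 - t) ≤
        ((n + 1 : ℕ) : ℝ) ^ (1 - t) - (1 - t) * ((n + 1 : ℕ) : ℝ) ^ (-t) := by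
      have hmul : ((n + 1 : ℕ) : ℝ) ^ (1 - t) = ((n + 1 : ℕ) : ℝ) * ((n + 1 : ℕ) : ℝ) ^ (-t) := by
        rw [sub_eq_add_neg, Real.rpow_add hx, Real.rpow_one]
      calc (n : ℝ) ^ (1 - t)
          = ((n + 1 : ℕ) : ℝ) ^ (1 - t) * (1 + -(1 / ((n + 1 : ℕ) : ℝ))) ^ (1 - t) := by
            rw [← Real.mul_rpow hx.le hnn, ← hfac]
        _ ≤ ((n + 1 : ℕ) : ℝ) ^ (1 - t) * (1 + (1 - t) * -(1 / ((n + 1 : ℕ) : ℝ))) := by gcongr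
        _ = _ := by
          rw [hmul]
          field_simp
          ring
    rw [le_div_iff₀ ht] at ih ⊢
    linarith

lemma sum_comp_rpow_neg_le {t : ℝ} (h0 : 0 < t) (h1 : t < 1) {n : ℕ} {s : Finset ℕ} {φ : ℕ → ℕ}
    (hmaps : ∀ i ∈ s, φ i ∈ Finset.Icc 1 n) (hinj : Set.InjOn φ s) :
    ∑ i ∈ s, (φ i : ℝ) ^ (-t) ≤ (n : ℝ) ^ (1 - t) / (1 - t) := by
  refine le_trans ?_ (sum_Icc_rpow_neg_le h0 h1 n)
  rw [← Finset.sum_image (f := fun d : ℕ => (d : ℝ) ^ (-t)) hinj]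
  exact Finset.sum_le_sum_of_subset_of_nonneg (Finset.image_subset_iff.2 hmaps)
    fun _ _ _ => by positivity

lemma mul_min_rpow_neg_le {t A x : ℝ} (h0 : 0 < t) (hA : 0 < A) {a b : ℕ} (ha : 0 < a)
    (hb : 0 < b) (h : A * min (a : ℝ) b ≤ x) :
    x ^ (-t) ≤ A ^ (-t) * ((a : ℝ) ^ (-t) + (b : ℝ) ^ (-t)) := by
  have ha' : (0 : ℝ) < a := by exact_mod_cast ha
  have hb' : (0 : ℝ) < b := by exact_mod_cast hb
  have hm : 0 < min (a : ℝ) b := lt_min ha' hb'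
  calc x ^ (-t) ≤ (A * min (a : ℝ) b) ^ (-t) :=
        Real.rpow_le_rpow_of_nonpos (by positivity) h (by linarith)
    _ = A ^ (-t) * (min (a : ℝ) b) ^ (-t) := Real.mul_rpow hA.le hm.le
    _ ≤ _ := by
      gcongr
      have := Real.rpow_pos_of_pos ha' (-t)
      have := Real.rpow_pos_of_pos hb' (-t)
      rcases min_choice (a : ℝ) b with h | h <;> rw [h] <;> linarith

/-- Sum of negative powers of the distances to a fixed circle point. -/
lemma sum_erase_norm_circlePt_sub_rpow_le {N : ℕ} (hN : 2 ≤ N) {t : ℝ} (h0 : 0 < t) (h1 : t < 1)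
    {k : ℕ} {r : ℝ} (hr : 0 < r) {j : ℕ} (hj : j ∈ Finset.Icc 1 k) :
    ∑ i ∈ (Finset.Icc 1 k).erase j, ‖circlePt N k r i - circlePt N k r j‖ ^ (-t)
      ≤ (4 * r / k) ^ (-t) * (4 * ((k : ℝ) ^ (1 - t) / (1 - t))) := by
  rw [Finset.mem_Icc] at hj
  have hk : (0 : ℝ) < k := by
    have : 0 < k := by omega
    exact_mod_cast this
  have hA : 0 < 4 * r / k := by positivity
  rw [← Finset.sum_filter_add_sum_filter_not _ (fun i => i < j)]
  set s₁ := ((Finset.Icc 1 k).erase j).filter (fun i => i < j)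
  set s₂ := ((Finset.Icc 1 k).erase j).filter (fun i => ¬ i < j)
  have hs₁ : ∀ i ∈ s₁, 1 ≤ i ∧ i < j := fun i hi => by
    simp only [s₁, Finset.mem_filter, Finset.mem_erase, Finset.mem_Icc] at hi; omega
  have hs₂ : ∀ i ∈ s₂, j < i ∧ i ≤ k := fun i hi => by
    simp only [s₂, Finset.mem_filter, Finset.mem_erase, Finset.mem_Icc] at hi; omega
  have e₁ : ∑ i ∈ s₁, ‖circlePt N k r i - circlePt N k r j‖ ^ (-t)
      ≤ (4 * r / k) ^ (-t) * (2 * ((k : ℝ) ^ (1 - t) / (1 - t))) := by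
    refine (Finset.sum_le_sum (g := fun i => (4 * r / k) ^ (-t) *
      (((j - i : ℕ) : ℝ) ^ (-t) + ((k + i - j : ℕ) : ℝ) ^ (-t))) fun i hi => ?_).trans ?_
    · have := hs₁ i hi
      rw [norm_sub_rev]
      exact mul_min_rpow_neg_le h0 hA (by omega) (by omega)
        (mul_min_le_norm_circlePt_sub hN hr.le (by omega) (by omega))
    · rw [← Finset.mul_sum, Finset.sum_add_distrib, two_mul]
      gcongr
      · refine sum_comp_rpow_neg_le h0 h1 (fun i hi => ?_) fun a ha b hb hab => ?_
        · have := hs₁ i hi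
          rw [Finset.mem_Icc]; omega
        · have := hs₁ a ha
          have := hs₁ b hb
          omega
      · refine sum_comp_rpow_neg_le h0 h1 (fun i hi => ?_) fun a ha b hb hab => ?_
        · have := hs₁ i hi
          rw [Finset.mem_Icc]; omega
        · have := hs₁ a ha
          have := hs₁ b hb
          omega
  have e₂ : ∑ i ∈ s₂, ‖circlePt N k r i - circlePt N k r j‖ ^ (-t)
      ≤ (4 * r / k) ^ (-t) * (2 * ((k : ℝ) ^ (1 - t) / (1 - t))) := by
    refine (Finset.sum_le_sum (g := fun i => (4 * r / k) ^ (-t) *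
      (((i - j : ℕ) : ℝ) ^ (-t) + ((k + j - i : ℕ) : ℝ) ^ (-t))) fun i hi => ?_).trans ?_
    · have := hs₂ i hi
      exact mul_min_rpow_neg_le h0 hA (by omega) (by omega)
        (mul_min_le_norm_circlePt_sub hN hr.le (by omega) (by omega))
    · rw [← Finset.mul_sum, Finset.sum_add_distrib, two_mul]
      gcongr
      · refine sum_comp_rpow_neg_le h0 h1 (fun i hi => ?_) fun a ha b hb hab => ?_
        · have := hs₂ i hi
          rw [Finset.mem_Icc]; omega
        · have := hs₂ a ha
          have := hs₂ b hb
          omega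
      · refine sum_comp_rpow_neg_le h0 h1 (fun i hi => ?_) fun a ha b hb hab => ?_
        · have := hs₂ i hi
          rw [Finset.mem_Icc]; omega
        · have := hs₂ a ha
          have := hs₂ b hb
          omega
  linarith

lemma circlePt_ne {N : ℕ} (hN : 2 ≤ N) {k : ℕ} {r : ℝ} (hr : 0 < r) {i j : ℕ}
    (hji : j < i) (hik : i < k + j) : circlePt N k r i ≠ circlePt N k r j := by
  rw [← sub_ne_zero, ← norm_pos_iff]
  refine lt_of_lt_of_le ?_ (mul_min_le_norm_circlePt_sub hN hr.le hji hik)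
  have h₁ : (0 : ℝ) < (i - j : ℕ) := by exact_mod_cast Nat.sub_pos_of_lt hji
  have h₂ : (0 : ℝ) < (k + j - i : ℕ) := by exact_mod_cast Nat.sub_pos_of_lt hik
  have h₃ : (0 : ℝ) < k := by
    have : 0 < k := by omega
    exact_mod_cast this
  have := lt_min h₁ h₂
  positivity

/-- A sum of decaying bumps is controlled by the pairwise distances of their centres. -/
lemma sum_one_add_norm_sub_rpow_le {ι E : Type*} [DecidableEq ι] [SeminormedAddCommGroup E]
    {t B : ℝ} (h0 : 0 < t) {s : Finset ι} (hs : s.Nonempty) {x : ι → E}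
    (hx : ∀ i ∈ s, ∀ j ∈ s, i ≠ j → 0 < ‖x i - x j‖)
    (hB : ∀ j ∈ s, ∑ i ∈ s.erase j, ‖x i - x j‖ ^ (-t) ≤ B) (y : E) :
    ∑ i ∈ s, (1 + ‖y - x i‖) ^ (-t) ≤ 1 + 2 ^ t * B := by
  obtain ⟨j, hj, hmin⟩ := s.exists_min_image (fun i => ‖y - x i‖) hs
  rw [← Finset.add_sum_erase s _ hj]
  refine add_le_add ?_ ?_
  · exact Real.rpow_le_one_of_one_le_of_nonpos (by linarith [norm_nonneg (y - x j)]) (by linarith)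
  · refine le_trans ?_ (mul_le_mul_of_nonneg_left (hB j hj) (by positivity))
    rw [Finset.mul_sum]
    refine Finset.sum_le_sum fun i hi => ?_
    obtain ⟨hij, hi⟩ := Finset.mem_erase.1 hi
    have hpos := hx i hi j hj hij
    have htri : ‖x i - x j‖ ≤ ‖y - x i‖ + ‖y - x j‖ := by
      rw [norm_sub_rev y (x i)]
      exact norm_sub_le_norm_sub_add_norm_sub _ _ _
    have := hmin i hi
    calc (1 + ‖y - x i‖) ^ (-t) ≤ (2⁻¹ * ‖x i - x j‖) ^ (-t) :=
          Real.rpow_le_rpow_of_nonpos (by positivity) (by linarith) (by linarith)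
      _ = 2 ^ t * ‖x i - x j‖ ^ (-t) := by
        rw [Real.mul_rpow (by norm_num) hpos.le, Real.inv_rpow two_pos.le, Real.rpow_neg two_pos.le,
          inv_inv]

/-- Uniform summability estimate (key3) for `k` bubbles on a circle of radius
comparable to `r₀ k^{1/τ₁}`. -/
theorem circle_points_uniform_summability
    (N : ℕ) (hN : 5 ≤ N)
    (m : ℝ) (hm1 : 2 ≤ m) (hm2 : m < (N : ℝ) - 2)
    (τ1 : ℝ) (hτ1 : τ1 = ((N : ℝ) - 2 - m) / ((N : ℝ) - 2))
    (r0 : ℝ) (hr0 : 0 < r0) :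
    ∃ C : ℝ, 0 < C ∧ ∃ k0 : ℕ,
      ∀ k : ℕ, k0 ≤ k →
        ∀ r ∈ Set.Icc (r0 * (k : ℝ) ^ (1 / τ1) - 1) (r0 * (k : ℝ) ^ (1 / τ1) + 1),
          (∑ i ∈ Finset.Icc 2 k,
            ‖circlePt N k r i - circlePt N k r 1‖ ^ (-τ1)) ≤ C ∧
          (∀ y : EuclideanSpace ℝ (Fin N),
            (∑ i ∈ Finset.Icc 1 k,
              (1 + ‖y - circlePt N k r i‖) ^ (-τ1)) ≤ C) := by
  have hN' : (5 : ℝ) ≤ N := by exact_mod_cast hN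
  have h0 : 0 < τ1 := by rw [hτ1]; exact div_pos (by linarith) (by linarith)
  have h1 : τ1 < 1 := by rw [hτ1, div_lt_one (by linarith)]; linarith
  have ht : 0 < 1 - τ1 := by linarith
  have hN2 : 2 ≤ N := by omega
  set B : ℝ := (2 * r0) ^ (-τ1) * (4 / (1 - τ1))
  have hB : 0 < B := by positivity
  have h2 : (1 : ℝ) ≤ 2 ^ τ1 := Real.one_le_rpow one_le_two h0.le
  refine ⟨1 + 2 ^ τ1 * B, by positivity, max 1 ⌈2 / r0⌉₊, fun k hk r hr => ?_⟩
  have hk1 : 1 ≤ k := (le_max_left _ _).trans hk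
  have hk1' : (1 : ℝ) ≤ k := by exact_mod_cast hk1
  have hk0 : (0 : ℝ) < k := by linarith
  have hk2 : 2 / r0 ≤ k := Nat.ceil_le.1 ((le_max_right _ _).trans hk)
  have hkpow : (k : ℝ) ≤ (k : ℝ) ^ (1 / τ1) :=
    Real.self_le_rpow_of_one_le hk1' (by rw [le_div_iff₀ h0]; linarith)
  have hμ : 2 ≤ r0 * (k : ℝ) ^ (1 / τ1) := by
    rw [div_le_iff₀ hr0] at hk2
    nlinarith
  have hr' : r0 * (k : ℝ) ^ (1 / τ1) ≤ 2 * r := by linarith [hr.1]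
  have hrpos : 0 < r := by linarith
  have hsum : ∀ j ∈ Finset.Icc 1 k, ∑ i ∈ (Finset.Icc 1 k).erase j,
      ‖circlePt N k r i - circlePt N k r j‖ ^ (-τ1) ≤ B := fun j hj => by
    refine (sum_erase_norm_circlePt_sub_rpow_le hN2 h0 h1 hrpos hj).trans ?_
    have hle : 2 * r0 * (k : ℝ) ^ (1 / τ1) / k ≤ 4 * r / k := by gcongr ?_ / _; linarith
    have hA : (4 * r / k) ^ (-τ1) ≤ (2 * r0) ^ (-τ1) * (k : ℝ) ^ (-(1 - τ1)) := by
      refine (Real.rpow_le_rpow_of_nonpos (by positivity) hle (by linarith)).trans (le_of_eq ?_)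
      rw [mul_div_assoc, Real.mul_rpow (by positivity) (by positivity)]
      congr 1
      rw [← Real.rpow_sub_one hk0.ne', ← Real.rpow_mul hk0.le]
      congr 1
      field_simp
    calc _ ≤ (2 * r0) ^ (-τ1) * (k : ℝ) ^ (-(1 - τ1)) * (4 * ((k : ℝ) ^ (1 - τ1) / (1 - τ1))) := by
          gcongr
      _ = B := by
        have := (Real.rpow_pos_of_pos hk0 (1 - τ1)).ne'
        rw [Real.rpow_neg hk0.le]
        simp only [B]
        field_simp
  refine ⟨?_, fun y => ?_⟩
  · have hIcc : Finset.Icc 2 k = (Finset.Icc 1 k).erase 1 := by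
      ext i
      simp only [Finset.mem_erase, Finset.mem_Icc]
      omega
    rw [hIcc]
    refine (hsum 1 (Finset.mem_Icc.2 ⟨le_rfl, hk1⟩)).trans ?_
    nlinarith
  · refine sum_one_add_norm_sub_rpow_le h0 (Finset.nonempty_Icc.2 hk1) (fun i hi j hj hij => ?_)
      hsum y
    rw [Finset.mem_Icc] at hi hj
    rw [norm_pos_iff, sub_ne_zero]
    rcases lt_or_gt_of_ne hij with h | h
    · exact (circlePt_ne hN2 hrpos h (by omega)).symm
    · exact circlePt_ne hN2 hrpos h (by omega)
end
end

section
/- Let N ≥ 5 be an integer, 2* = 2N/(N−2), m ∈ [2, N−2), τ1 = (N−2−m)/(N−2), r0 > 0, and let α be a real number with N/2 − 1 + τ1 ≤ α < N−2. Then there exist a constant C > 0 and an integer k0 such that for every integer k ≥ k0, setting μ = k^{1/τ1} and σ_k = k^{1/(N−2)}, for every r ∈ [r0 μ − 1, r0 μ + 1] and every y ∈ ℝ^N ∖ P_1: −Δϖ_{r,α}(y) ≥ C σ_k^{4 − 4α/(N−2)} ϖ_{r,N−2}(y)^{2*−2} ϖ_{r,α}(y) + (1/2) α (N−2−α) ϖ_{r,α+2}(y),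 where Δ is the classical Laplacian and all functions ϖ_{r,·} are smooth on ℝ^N ∖ {x^1,…,x^k}. -/
noncomputable section

/-- The classical Laplacian of `f : ℝ^N → ℝ`, as the sum of the second partial
derivatives in the coordinate directions. -/
noncomputable def laplacian {N : ℕ} (f : EuclideanSpace ℝ (Fin N) → ℝ)
    (y : EuclideanSpace ℝ (Fin N)) : ℝ :=
  ∑ i : Fin N,
    fderiv ℝ (fun z => fderiv ℝ f z (EuclideanSpace.single i 1)) y
      (EuclideanSpace.single i 1)

/-- The barrier function `ϖ_{r,α}(y) = Σ_{i=1}^k (1 + |y − x^i|)^{−α}`. -/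
noncomputable def varpi (N k : ℕ) (r α : ℝ) (y : EuclideanSpace ℝ (Fin N)) : ℝ :=
  ∑ i ∈ Finset.Icc 1 k, (1 + ‖y - circlePt N k r i‖) ^ (-α)

open Finset

theorem sq_dist_circle (r s t : ℝ) :
    (r * Real.cos s - r * Real.cos t) ^ 2 + (r * Real.sin s - r * Real.sin t) ^ 2 =
      (2 * r * Real.sin ((s - t) / 2)) ^ 2 := by
  have h1 := Real.cos_two_mul ((s - t) / 2)
  rw [mul_div_cancel₀ _ (two_ne_zero' ℝ), Real.cos_sub] at h1
  linear_combination r ^ 2 * (Real.sin_sq_add_cos_sq s + Real.sin_sq_add_cos_sq t) -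
    4 * r ^ 2 * Real.sin_sq_add_cos_sq ((s - t) / 2) - 2 * r ^ 2 * h1

theorem norm_circlePt_sub_circlePt {N : ℕ} (hN : 2 ≤ N) (k : ℕ) {r : ℝ} (hr : 0 ≤ r) (i l : ℕ) :
    ‖circlePt N k r i - circlePt N k r l‖ =
      2 * r * |Real.sin (Real.pi * (Nat.dist i l : ℕ) / k)| := by
  have habs : |Real.sin (Real.pi * (Nat.dist i l : ℕ) / k)| =
      |Real.sin (Real.pi * ((i : ℝ) - l) / k)| := by
    rcases le_total i l with h | h
    · rw [Nat.dist_eq_sub_of_le h, Nat.cast_sub h, ← abs_neg, ← Real.sin_neg]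
      congr 2
      ring
    · rw [Nat.dist_eq_sub_of_le_right h, Nat.cast_sub h]
  rw [habs, ← abs_of_nonneg (show 0 ≤ 2 * r by positivity), ← abs_mul,
    ← abs_of_nonneg (norm_nonneg _), ← sq_eq_sq_iff_abs_eq_abs, EuclideanSpace.real_norm_sq_eq]
  obtain ⟨n, rfl⟩ := Nat.exists_eq_add_of_le' hN
  rw [Fin.sum_univ_succ, Fin.sum_univ_succ]
  simp only [circlePt, PiLp.sub_apply, Fin.val_zero, Fin.val_succ]
  simp only [if_true, zero_add, one_ne_zero, if_false, Nat.add_eq_zero_iff, and_false,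
    Nat.add_eq_right, sub_zero, ne_eq, OfNat.ofNat_ne_zero, not_false_eq_true, zero_pow,
    sum_const_zero, add_zero]
  rw [sq_dist_circle]
  congr 3
  ring

theorem norm_circlePt_sub_circlePt_le {N : ℕ} (hN : 2 ≤ N) (k : ℕ) {r : ℝ} (hr : 0 ≤ r)
    (i l : ℕ) :
    ‖circlePt N k r i - circlePt N k r l‖ ≤ 2 * Real.pi * (r / k * Nat.dist i l) := by
  rw [norm_circlePt_sub_circlePt hN k hr]
  refine (mul_le_mul_of_nonneg_left Real.abs_sin_le_abs (by positivity)).trans_eq ?_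
  rw [abs_of_nonneg (by positivity)]
  ring

theorem le_norm_circlePt_sub_circlePt {N : ℕ} (hN : 2 ≤ N) {k : ℕ} {r : ℝ} (hr : 0 ≤ r)
    {i l : ℕ} (hi : i ∈ Icc 1 k) (hl : l ∈ Icc 1 k) :
    4 * (r / k * min (Nat.dist i l : ℕ) (k - Nat.dist i l : ℕ)) ≤
      ‖circlePt N k r i - circlePt N k r l‖ := by
  rw [norm_circlePt_sub_circlePt hN k hr]
  rw [mem_Icc] at hi hl
  have hk : (0 : ℝ) < k := by exact_mod_cast (by omega : 0 < k)
  have hj : Nat.dist i l ≤ k := by simp only [Nat.dist]; omega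
  generalize Nat.dist i l = j at hj
  have key (n : ℕ) (hn : 2 * n ≤ k) : 2 * (n / k : ℝ) ≤ Real.sin (Real.pi * n / k) := by
    have hn' : (2 * n : ℝ) ≤ k := by exact_mod_cast hn
    refine le_trans (le_of_eq ?_) (Real.mul_le_sin (by positivity) ?_)
    · field_simp
    · rw [div_le_div_iff₀ hk two_pos]
      nlinarith [Real.pi_pos]
  have aux (n : ℕ) (hn : 2 * n ≤ k) :
      4 * (r / k * n) ≤ 2 * r * |Real.sin (Real.pi * n / k)| :=
    calc 4 * (r / k * n) = 2 * r * (2 * (n / k : ℝ)) := by ring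
      _ ≤ _ := mul_le_mul_of_nonneg_left ((key n hn).trans (le_abs_self _)) (by positivity)
  rcases le_total (2 * j) k with h | h
  · refine le_trans ?_ (aux j h)
    gcongr
    exact min_le_left _ _
  · refine le_trans ?_ ((aux (k - j) (by omega)).trans_eq ?_)
    · gcongr
      exact min_le_right _ _
    · rw [Nat.cast_sub hj, mul_sub, sub_div, mul_div_cancel_right₀ _ hk.ne', Real.sin_pi_sub]

theorem sum_range_mul_div (M : ℕ) (hM : 0 < M) (f : ℕ → ℝ) (B : ℕ) :
    ∑ j ∈ range (M * B), f (j / M) = M * ∑ b ∈ range B, f b := by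
  induction B with
  | zero => simp
  | succ B ih =>
    rw [Nat.mul_succ, sum_range_add, ih, sum_range_succ, mul_add]
    congr 1
    rw [sum_congr rfl (g := fun _ => f B)]
    · simp
    · intro i hi
      rw [Nat.mul_add_div hM, Nat.div_eq_of_lt (mem_range.1 hi), add_zero]

theorem sum_natDist_le {k l : ℕ} (hl : l ∈ Icc 1 k) (h : ℕ → ℝ) (h0 : ∀ j, 0 ≤ h j) :
    ∑ i ∈ Icc 1 k, h (Nat.dist i l) ≤ 2 * ∑ j ∈ range k, h j := by
  rw [mem_Icc] at hl
  rw [← sum_filter_add_sum_filter_not _ (· ≤ l), two_mul]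
  have key (s : Finset ℕ) (hs : s ⊆ Icc 1 k) (hinj : Set.InjOn (Nat.dist · l) s) :
      ∑ i ∈ s, h (Nat.dist i l) ≤ ∑ j ∈ range k, h j := by
    rw [← sum_image hinj]
    refine sum_le_sum_of_subset_of_nonneg ?_ fun j _ _ => h0 j
    intro j hj
    obtain ⟨i, his, rfl⟩ := mem_image.1 hj
    have := mem_Icc.1 (hs his)
    simp only [mem_range, Nat.dist]
    omega
  refine add_le_add (key _ (filter_subset _ _) ?_) (key _ (filter_subset _ _) ?_) <;>
  · intro a ha b hb hab
    simp only [coe_filter, mem_Icc, Set.mem_ofPred_eq] at ha hb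
    simp only [Nat.dist] at hab
    omega

/-- For `0 ≤ d` and `0 < δ`, the number of `j < k` with `δ * j ≤ d`. -/
def blockLength (d δ : ℝ) (k : ℕ) : ℕ := min (⌊d / δ⌋₊ + 1) k

theorem blockLength_pos (d δ : ℝ) {k : ℕ} (hk : 0 < k) : 0 < blockLength d δ k :=
  lt_min (Nat.succ_pos _) hk

theorem blockLength_le {d δ : ℝ} (hd : 0 < d) (hδ : 0 < δ) (k : ℕ) :
    (blockLength d δ k : ℝ) ≤ d / δ + 1 :=
  calc (blockLength d δ k : ℝ) ≤ (⌊d / δ⌋₊ + 1 : ℕ) := by exact_mod_cast min_le_left _ _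
    _ ≤ d / δ + 1 := by
      push_cast
      gcongr
      exact Nat.floor_le (by positivity)

theorem mul_le_of_lt_blockLength {d δ : ℝ} (hd : 0 < d) (hδ : 0 < δ) {k j : ℕ}
    (hj : j < blockLength d δ k) : δ * j ≤ d := by
  have h : (j : ℝ) ≤ d / δ :=
    (Nat.le_floor_iff (by positivity)).1 (Nat.lt_succ_iff.1 (hj.trans_le (min_le_left _ _)))
  rw [le_div_iff₀ hδ] at h
  linarith

theorem div_blockLength_mul_le {d δ : ℝ} (hδ : 0 < δ) {k j : ℕ} (hj : j < k) :
    ((j / blockLength d δ k : ℕ) : ℝ) * d ≤ δ * j := by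
  rcases le_total (⌊d / δ⌋₊ + 1) k with h | h
  · rw [blockLength, min_eq_left h]
    have h1 : d / δ ≤ ((⌊d / δ⌋₊ + 1 : ℕ) : ℝ) := by
      push_cast
      exact (Nat.lt_floor_add_one _).le
    rw [div_le_iff₀ hδ] at h1
    have h2 : ((j / (⌊d / δ⌋₊ + 1) : ℕ) : ℝ) * ((⌊d / δ⌋₊ + 1 : ℕ) : ℝ) ≤ j := by
      exact_mod_cast Nat.div_mul_le_self _ _
    calc _ ≤ ((j / (⌊d / δ⌋₊ + 1) : ℕ) : ℝ) * (((⌊d / δ⌋₊ + 1 : ℕ) : ℝ) * δ) := by gcongr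
      _ = δ * (((j / (⌊d / δ⌋₊ + 1) : ℕ) : ℝ) * ((⌊d / δ⌋₊ + 1 : ℕ) : ℝ)) := by ring
      _ ≤ δ * j := by gcongr
  · rw [blockLength, min_eq_right h, Nat.div_eq_of_lt hj]
    simp only [Nat.cast_zero, zero_mul]
    positivity

theorem summable_one_add_rpow {β : ℝ} (hβ : 1 < β) :
    Summable fun b : ℕ => (1 + b : ℝ) ^ (-β) := by
  have := (summable_nat_add_iff 1).2 (Real.summable_nat_rpow.2 (neg_lt_neg hβ))
  refine this.congr fun b => ?_
  push_cast
  rw [add_comm]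

theorem tsum_one_add_rpow_pos {β : ℝ} (hβ : 1 < β) : 0 < ∑' b : ℕ, (1 + b : ℝ) ^ (-β) :=
  (summable_one_add_rpow hβ).tsum_pos (fun b => by positivity) 0 (by simp)

theorem sum_range_rpow_le {d δ β : ℝ} (hd : 0 < d) (hδ : 0 < δ) (hβ : 1 < β) (k : ℕ) :
    ∑ j ∈ range k, (d + δ * j) ^ (-β) ≤
      (∑' b : ℕ, (1 + b : ℝ) ^ (-β)) * (blockLength d δ k * d ^ (-β)) := by
  rcases k.eq_zero_or_pos with rfl | hk
  · simp [blockLength]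
  set M := blockLength d δ k
  have hMpos : 0 < M := blockLength_pos d δ hk
  calc ∑ j ∈ range k, (d + δ * j) ^ (-β)
      ≤ ∑ j ∈ range k, (1 + (j / M : ℕ) : ℝ) ^ (-β) * d ^ (-β) := by
        refine sum_le_sum fun j hj => ?_
        rw [← Real.mul_rpow (by positivity) hd.le]
        refine Real.rpow_le_rpow_of_nonpos (by positivity) ?_ (by linarith)
        linarith [div_blockLength_mul_le (d := d) hδ (mem_range.1 hj)]
    _ ≤ ∑ j ∈ range (M * k), (1 + (j / M : ℕ) : ℝ) ^ (-β) * d ^ (-β) := by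
        refine sum_le_sum_of_subset_of_nonneg ?_ fun _ _ _ => by positivity
        exact range_subset_range.2 (Nat.le_mul_of_pos_left k hMpos)
    _ = (∑ b ∈ range k, (1 + b : ℝ) ^ (-β)) * (M * d ^ (-β)) := by
        rw [← sum_mul, sum_range_mul_div M hMpos fun b => (1 + b : ℝ) ^ (-β)]
        ring
    _ ≤ _ := by
        gcongr
        exact (summable_one_add_rpow hβ).sum_le_tsum _ fun b _ => by positivity

theorem sum_rpow_le_of_natDist_le {a : ℕ → ℝ} {d δ β : ℝ} {k l : ℕ} (hd : 0 < d) (hδ : 0 < δ)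
    (hβ : 1 < β) (hl : l ∈ Icc 1 k)
    (ha : ∀ i ∈ Icc 1 k, d + δ * min (Nat.dist i l : ℕ) (k - Nat.dist i l : ℕ) ≤ 2 * a i) :
    ∑ i ∈ Icc 1 k, a i ^ (-β) ≤
      4 * 2 ^ β * (∑' b : ℕ, (1 + b : ℝ) ^ (-β)) * (blockLength d δ k * d ^ (-β)) := by
  set h : ℕ → ℝ := fun j => (d + δ * j) ^ (-β)
  have h0 (j : ℕ) : 0 ≤ h j := by positivity
  have hterm : ∀ i ∈ Icc 1 k,
      a i ^ (-β) ≤ 2 ^ β * (h (Nat.dist i l) + h (k - 1 - Nat.dist i l)) := by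
    intro i hi
    have hle := ha i hi
    have hlt : Nat.dist i l < k := by
      rw [mem_Icc] at hi hl
      simp only [Nat.dist]
      omega
    generalize Nat.dist i l = j at hle hlt
    have key (n : ℕ) (hn : d + δ * n ≤ 2 * a i) : a i ^ (-β) ≤ 2 ^ β * h n := by
      have : (2 * a i) ^ (-β) ≤ h n :=
        Real.rpow_le_rpow_of_nonpos (by positivity) hn (by linarith)
      have hai : 0 < a i := by
        have : 0 < d + δ * n := by positivity
        linarith
      rw [Real.mul_rpow two_pos.le hai.le] at this
      calc a i ^ (-β) = 2 ^ β * (2 ^ (-β) * a i ^ (-β)) := by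
            rw [← mul_assoc, ← Real.rpow_add two_pos, add_neg_cancel, Real.rpow_zero, one_mul]
        _ ≤ _ := by gcongr
    rw [mul_add]
    have hp (n : ℕ) : 0 ≤ 2 ^ β * h n := mul_nonneg (by positivity) (h0 n)
    rcases le_total j (k - j) with hj | hj
    · rw [min_eq_left (by exact_mod_cast hj)] at hle
      linarith [key _ hle, hp (k - 1 - j)]
    · rw [min_eq_right (by exact_mod_cast hj)] at hle
      have : ((k - 1 - j : ℕ) : ℝ) ≤ (k - j : ℕ) := by exact_mod_cast (by omega)
      have hle' : d + δ * (k - 1 - j : ℕ) ≤ 2 * a i := le_trans (by gcongr) hle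
      linarith [key _ hle', hp j]
  calc ∑ i ∈ Icc 1 k, a i ^ (-β)
      ≤ ∑ i ∈ Icc 1 k, 2 ^ β * (h (Nat.dist i l) + h (k - 1 - Nat.dist i l)) :=
        sum_le_sum hterm
    _ = 2 ^ β * (∑ i ∈ Icc 1 k, h (Nat.dist i l) +
          ∑ i ∈ Icc 1 k, h (k - 1 - Nat.dist i l)) := by
        rw [← mul_sum, sum_add_distrib]
    _ ≤ 2 ^ β * (2 * ∑ j ∈ range k, h j + 2 * ∑ j ∈ range k, h (k - 1 - j)) := by
        gcongr
        · exact sum_natDist_le hl h h0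
        · exact sum_natDist_le hl (fun j => h (k - 1 - j)) fun _ => h0 _
    _ = 4 * 2 ^ β * ∑ j ∈ range k, h j := by
        rw [sum_range_reflect]
        ring
    _ ≤ 4 * 2 ^ β * ((∑' b : ℕ, (1 + b : ℝ) ^ (-β)) * (blockLength d δ k * d ^ (-β))) := by
        gcongr
        exact sum_range_rpow_le hd hδ hβ k
    _ = _ := by ring

theorem le_sum_rpow_of_le_natDist {a : ℕ → ℝ} {d δ c β : ℝ} {k l : ℕ} (hd : 0 < d) (hδ : 0 < δ)
    (hc : 0 ≤ c) (hβ : 0 ≤ β) (hl : l ∈ Icc 1 k) (ha0 : ∀ i ∈ Icc 1 k, 0 < a i)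
    (ha : ∀ i ∈ Icc 1 k, a i ≤ d + c * (δ * Nat.dist i l)) :
    (1 + c) ^ (-β) * (blockLength d δ k * d ^ (-β)) ≤ ∑ i ∈ Icc 1 k, a i ^ (-β) := by
  set M := blockLength d δ k
  have hMk : M ≤ k := min_le_right _ _
  rw [mem_Icc] at hl
  have hMpos : 0 < M := blockLength_pos d δ (by omega)
  let s : Finset ℕ := Ico (max l M + 1 - M) (max l M + 1)
  have hs : s ⊆ Icc 1 k := by
    intro i hi
    simp only [s, mem_Ico, mem_Icc] at hi ⊢
    omega
  have hcard : #s = M := by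
    simp only [s, Nat.card_Ico]
    omega
  calc _ = #s • ((1 + c) * d) ^ (-β) := by
        rw [hcard, nsmul_eq_mul, Real.mul_rpow (by positivity) hd.le]
        ring
    _ ≤ ∑ i ∈ s, a i ^ (-β) := by
        refine card_nsmul_le_sum _ _ _ fun i hi => ?_
        refine Real.rpow_le_rpow_of_nonpos (ha0 i (hs hi)) ?_ (by linarith)
        have hlt : Nat.dist i l < blockLength d δ k := by
          simp only [s, mem_Ico] at hi
          simp only [Nat.dist]
          omega
        nlinarith [ha i (hs hi), mul_le_of_lt_blockLength hd hδ hlt]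
    _ ≤ _ := sum_le_sum_of_subset_of_nonneg hs fun i hi _ =>
        Real.rpow_nonneg (ha0 i hi).le _

theorem hasFDerivAt_norm_sub {E : Type*} [NormedAddCommGroup E] [InnerProductSpace ℝ E] {x z : E}
    (h : z ≠ x) : HasFDerivAt (fun w => ‖w - x‖) (‖z - x‖⁻¹ • innerSL ℝ (z - x)) z := by
  have h0 : ‖z - x‖ ≠ 0 := norm_ne_zero_iff.2 (sub_ne_zero.2 h)
  have h1 := ((hasFDerivAt_id z).sub_const x).norm_sq.sqrt (pow_ne_zero 2 h0)
  simp only [id, Real.sqrt_sq (norm_nonneg _)] at h1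
  refine h1.congr_fderiv ?_
  ext v
  simp
  field_simp

theorem hasFDerivAt_one_add_norm_rpow {E : Type*} [NormedAddCommGroup E] [InnerProductSpace ℝ E]
    {x z : E} (h : z ≠ x) (β : ℝ) :
    HasFDerivAt (fun w => (1 + ‖w - x‖) ^ β)
      ((β * (1 + ‖z - x‖) ^ (β - 1) * ‖z - x‖⁻¹) • innerSL ℝ (z - x)) z := by
  refine (((hasFDerivAt_norm_sub h).const_add 1).rpow_const
    (Or.inl (by positivity))).congr_fderiv ?_
  rw [smul_smul]

theorem neg_laplacian_one_add_norm_rpow {N : ℕ} (α : ℝ) {x y : EuclideanSpace ℝ (Fin N)}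
    (h : y ≠ x) :
    -∑ j : Fin N, fderiv ℝ (fun z => -α * (1 + ‖z - x‖) ^ (-α - 1) * ‖z - x‖⁻¹ * (z j - x j)) y
      (EuclideanSpace.single j 1) =
    α * (N - 2 - α + (N - 1) * ‖y - x‖⁻¹) * (1 + ‖y - x‖) ^ (-(α + 2)) := by
  have h0 : ‖y - x‖ ≠ 0 := norm_ne_zero_iff.2 (sub_ne_zero.2 h)
  have hp : 0 < 1 + ‖y - x‖ := by positivity
  have hj (j : Fin N) : HasFDerivAt (fun z : EuclideanSpace ℝ (Fin N) => z j - x j)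
      (EuclideanSpace.proj j : EuclideanSpace ℝ (Fin N) →L[ℝ] ℝ) y :=
    (EuclideanSpace.proj j : EuclideanSpace ℝ (Fin N) →L[ℝ] ℝ).hasFDerivAt.sub_const _
  have hinv := (hasDerivAt_inv h0).comp_hasFDerivAt y (hasFDerivAt_norm_sub h)
  have e1 : (1 + ‖y - x‖) ^ (-α - 1) = (1 + ‖y - x‖) ^ (-(α + 2)) * (1 + ‖y - x‖) := by
    rw [← Real.rpow_add_one hp.ne']
    congr 1
    ring
  have e2 : (1 + ‖y - x‖) ^ (-α - 1 - 1) = (1 + ‖y - x‖) ^ (-(α + 2)) := by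
    congr 1
    ring
  have key (j : Fin N) : fderiv ℝ
      (fun z => -α * (1 + ‖z - x‖) ^ (-α - 1) * ‖z - x‖⁻¹ * (z j - x j)) y
      (EuclideanSpace.single j 1) = (1 + ‖y - x‖) ^ (-(α + 2)) *
        ((α * (α + 1) * ‖y - x‖⁻¹ ^ 2 + α * (1 + ‖y - x‖) * ‖y - x‖⁻¹ ^ 3) * (y - x) j ^ 2 -
          α * (1 + ‖y - x‖) * ‖y - x‖⁻¹) := by
    have := (((hasFDerivAt_one_add_norm_rpow h (-α - 1)).const_mul (-α)).fun_mul hinv).fun_mul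
      (hj j)
    simp only [Function.comp_def] at this
    rw [HasFDerivAt.fderiv this]
    simp [EuclideanSpace.inner_single_right, e1, e2]
    ring
  simp_rw [key]
  rw [← mul_sum, sum_sub_distrib, ← mul_sum, ← EuclideanSpace.real_norm_sq_eq]
  simp
  field_simp
  ring

theorem neg_laplacian_varpi {N k : ℕ} {r α : ℝ} {y : EuclideanSpace ℝ (Fin N)}
    (hy : ∀ i ∈ Icc 1 k, y ≠ circlePt N k r i) :
    -laplacian (varpi N k r α) y = ∑ i ∈ Icc 1 k,
      α * (N - 2 - α + (N - 1) * ‖y - circlePt N k r i‖⁻¹) *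
        (1 + ‖y - circlePt N k r i‖) ^ (-(α + 2)) := by
  have hev : ∀ᶠ z in nhds y, ∀ i ∈ Icc 1 k, z ≠ circlePt N k r i :=
    (Filter.eventually_all_finset _).2 fun i hi => isOpen_ne.mem_nhds (hy i hi)
  have hfd (j : Fin N) :
      (fun z => fderiv ℝ (varpi N k r α) z (EuclideanSpace.single j 1)) =ᶠ[nhds y]
        fun z => ∑ i ∈ Icc 1 k, -α * (1 + ‖z - circlePt N k r i‖) ^ (-α - 1) *
          ‖z - circlePt N k r i‖⁻¹ * (z j - circlePt N k r i j) := by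
    filter_upwards [hev] with z hz
    have := HasFDerivAt.fun_sum fun i hi => hasFDerivAt_one_add_norm_rpow (hz i hi) (-α)
    change HasFDerivAt (varpi N k r α) _ z at this
    rw [this.fderiv]
    simp [EuclideanSpace.inner_single_right]
  rw [sum_congr rfl fun i hi => (neg_laplacian_one_add_norm_rpow α (hy i hi)).symm, sum_neg_distrib,
    sum_comm, laplacian]
  congr 1
  refine sum_congr rfl fun j _ => ?_
  rw [(hfd j).fderiv_eq, fderiv_fun_sum]
  · simp
  · intro i hi
    have h0 : ‖y - circlePt N k r i‖ ≠ 0 := norm_ne_zero_iff.2 (sub_ne_zero.2 (hy i hi))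
    have h1 := (hasFDerivAt_one_add_norm_rpow (hy i hi) (-α - 1)).differentiableAt
    have h2 := (hasFDerivAt_norm_sub (hy i hi)).differentiableAt
    have h3 : DifferentiableAt ℝ
        (fun z : EuclideanSpace ℝ (Fin N) => z j - circlePt N k r i j) y :=
      (EuclideanSpace.proj j : EuclideanSpace ℝ (Fin N) →L[ℝ] ℝ).differentiableAt.sub_const _
    exact ((h1.const_mul _).mul (h2.inv h0)).mul h3

theorem mul_varpi_le_neg_laplacian_varpi {N k : ℕ} (hN : 1 ≤ N) {r α : ℝ} (hα : 0 ≤ α)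
    {y : EuclideanSpace ℝ (Fin N)} (hy : ∀ i ∈ Icc 1 k, y ≠ circlePt N k r i) :
    α * (N - 2 - α) * varpi N k r (α + 2) y ≤ -laplacian (varpi N k r α) y := by
  rw [neg_laplacian_varpi hy, varpi, mul_sum]
  have hN' : (0 : ℝ) ≤ N - 1 := by
    rw [sub_nonneg]
    exact_mod_cast hN
  refine sum_le_sum fun i _ => ?_
  gcongr
  exact le_add_of_nonneg_right (by positivity)

theorem exists_varpi_bounds {N k : ℕ} (hN : 2 ≤ N) (hk : 0 < k) {r : ℝ} (hr : 0 < r)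
    (y : EuclideanSpace ℝ (Fin N)) :
    ∃ l ∈ Icc 1 k, ∃ d, d = 1 + ‖y - circlePt N k r l‖ ∧
      (∀ β, 1 < β → varpi N k r β y ≤
        4 * 2 ^ β * (∑' b : ℕ, (1 + b : ℝ) ^ (-β)) * (blockLength d (r / k) k * d ^ (-β))) ∧
      ∀ β, 0 ≤ β →
        (1 + 2 * Real.pi) ^ (-β) * (blockLength d (r / k) k * d ^ (-β)) ≤ varpi N k r β y := by
  obtain ⟨l, hl, hmin⟩ := exists_min_image (Icc 1 k) (fun i => ‖y - circlePt N k r i‖)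
    ⟨1, mem_Icc.2 ⟨le_rfl, hk⟩⟩
  have hδ : 0 < r / k := by positivity
  refine ⟨l, hl, _, rfl, fun β hβ => ?_, fun β hβ => ?_⟩
  · refine sum_rpow_le_of_natDist_le (by positivity) hδ hβ hl fun i hi => ?_
    have h1 := le_norm_circlePt_sub_circlePt hN hr.le hi hl
    have h2 := norm_sub_le_norm_sub_add_norm_sub (circlePt N k r i) y (circlePt N k r l)
    rw [norm_sub_rev _ y] at h2
    have h3 := hmin i hi
    have h4 : 0 ≤ r / k * min (Nat.dist i l : ℕ) (k - Nat.dist i l : ℕ) := by positivity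
    push_cast at h1 h4 ⊢
    linarith
  · refine le_sum_rpow_of_le_natDist (by positivity) hδ (by positivity) hβ hl
      (fun i _ => by positivity) fun i _ => ?_
    have h1 := norm_circlePt_sub_circlePt_le hN k hr.le l i
    have h2 := norm_sub_le_norm_sub_add_norm_sub y (circlePt N k r l) (circlePt N k r i)
    rw [Nat.dist_comm] at h1
    linarith

theorem exists_rpow_mul_varpi_le {N : ℕ} (hN : 5 ≤ N) {α : ℝ} (hα : ((N : ℝ) - 2) / 2 ≤ α)
    {c : ℝ} (hc : 0 < c) :
    ∃ K : ℝ, 0 < K ∧ ∀ k : ℕ, 0 < k → ∀ r σ : ℝ, 1 ≤ σ → c * σ ≤ r / k →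
      ∀ y : EuclideanSpace ℝ (Fin N), (∀ i ∈ Icc 1 k, σ ≤ ‖y - circlePt N k r i‖) →
        σ ^ (4 - 4 * α / ((N : ℝ) - 2)) * varpi N k r ((N : ℝ) - 2) y ^ (4 / ((N : ℝ) - 2)) *
          varpi N k r α y ≤ K * varpi N k r (α + 2) y := by
  have hN' : (5 : ℝ) ≤ N := by exact_mod_cast hN
  set n : ℝ := (N : ℝ) - 2
  have hn3 : 3 ≤ n := by linarith
  have hα1 : 1 < α := by linarith
  set A : ℝ → ℝ := fun β => 4 * 2 ^ β * (∑' b : ℕ, (1 + b : ℝ) ^ (-β))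
  have hApos (β : ℝ) (hβ : 1 < β) : 0 < A β := mul_pos (by positivity) (tsum_one_add_rpow_pos hβ)
  have hAn := hApos n (by linarith)
  have hAα := hApos α hα1
  refine ⟨(A n * (1 / c + 1)) ^ (4 / n) * (A α * (1 + 2 * Real.pi) ^ (α + 2)), by positivity,
    fun k hk r σ hσ hδ y hy => ?_⟩
  have hkpos : (0 : ℝ) < k := by exact_mod_cast hk
  have hσ0 : 0 < σ := by linarith
  have hδ0 : 0 < r / k := lt_of_lt_of_le (by positivity) hδ
  have hr : 0 < r := (div_pos_iff_of_pos_right hkpos).1 hδ0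
  obtain ⟨l, hl, d, hd, hup, hlow⟩ := exists_varpi_bounds (by omega : 2 ≤ N) hk hr y
  have hd0 : 0 < d := by rw [hd]; positivity
  have hσd : σ ≤ d := by linarith [hy l hl]
  have hdσ : 1 ≤ d / σ := (one_le_div hσ0).2 hσd
  have hVn : 0 ≤ varpi N k r n y := sum_nonneg fun i _ => by positivity
  have hVα : 0 ≤ varpi N k r α y := sum_nonneg fun i _ => by positivity
  have hn_bound : varpi N k r n y ^ (4 / n) ≤
      (A n * (1 / c + 1)) ^ (4 / n) * ((d / σ) ^ 2 * (d ^ 4)⁻¹) := by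
    have h1 : varpi N k r n y ≤ A n * (1 / c + 1) * (d / σ * d ^ (-n)) := by
      refine (hup n (by linarith)).trans ?_
      have h2 : (blockLength d (r / k) k : ℝ) ≤ (1 / c + 1) * (d / σ) :=
        calc _ ≤ d / (r / k) + 1 := blockLength_le hd0 hδ0 k
          _ ≤ d / (c * σ) + d / σ := by gcongr
          _ = _ := by field_simp
      calc _ ≤ A n * ((1 / c + 1) * (d / σ) * d ^ (-n)) := by
            gcongr
        _ = _ := by ring
    calc _ ≤ (A n * (1 / c + 1) * (d / σ * d ^ (-n))) ^ (4 / n) := by gcongr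
      _ = (A n * (1 / c + 1)) ^ (4 / n) * ((d / σ) ^ (4 / n) * (d ^ 4)⁻¹) := by
        rw [Real.mul_rpow (by positivity) (by positivity),
          Real.mul_rpow (x := d / σ) (by positivity) (by positivity), ← Real.rpow_mul hd0.le,
          show -n * (4 / n) = -(4 : ℕ) by field_simp; norm_num, Real.rpow_neg hd0.le,
          Real.rpow_natCast]
      _ ≤ _ := by
        gcongr
        rw [← Real.rpow_two]
        refine Real.rpow_le_rpow_of_exponent_le hdσ ?_
        rw [div_le_iff₀ (by linarith)]
        linarith
  have hσ_bound : σ ^ (4 - 4 * α / n) ≤ σ ^ 2 := by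
    rw [← Real.rpow_two]
    refine Real.rpow_le_rpow_of_exponent_le hσ ?_
    have : 2 ≤ 4 * α / n := by
      rw [le_div_iff₀ (by linarith)]
      linarith
    linarith
  have hα_bound : varpi N k r α y ≤
      A α * (1 + 2 * Real.pi) ^ (α + 2) * d ^ 2 * varpi N k r (α + 2) y := by
    have h1 : d ^ (-α) = d ^ 2 * d ^ (-(α + 2)) := by
      rw [← Real.rpow_two, ← Real.rpow_add hd0]
      congr 1
      ring
    have h2 : (1 + 2 * Real.pi) ^ (α + 2) * (1 + 2 * Real.pi) ^ (-(α + 2)) = 1 := by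
      rw [← Real.rpow_add (by positivity), add_neg_cancel, Real.rpow_zero]
    calc _ ≤ A α * (blockLength d (r / k) k * d ^ (-α)) := hup α hα1
      _ = A α * (1 + 2 * Real.pi) ^ (α + 2) * d ^ 2 * ((1 + 2 * Real.pi) ^ (-(α + 2)) *
          (blockLength d (r / k) k * d ^ (-(α + 2)))) := by
        rw [h1]
        linear_combination (-(A α * d ^ 2 * (blockLength d (r / k) k * d ^ (-(α + 2))))) * h2
      _ ≤ _ := by
        gcongr
        exact hlow (α + 2) (by linarith)
  calc _ ≤ σ ^ 2 * ((A n * (1 / c + 1)) ^ (4 / n) * ((d / σ) ^ 2 * (d ^ 4)⁻¹)) *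
        (A α * (1 + 2 * Real.pi) ^ (α + 2) * d ^ 2 * varpi N k r (α + 2) y) := by gcongr
    _ = _ := by
      field_simp

theorem mul_rpow_le_div_of_le {r0 a b k r : ℝ} (hr0 : 0 < r0) (hk : 1 ≤ k) (hk0 : 2 / r0 ≤ k)
    (hb : 0 ≤ b) (hab : 1 + b ≤ a) (hr : r0 * k ^ a - 1 ≤ r) : r0 / 2 * k ^ b ≤ r / k := by
  have hkpos : 0 < k := by linarith
  have h1 : k * k ^ b ≤ k ^ a := by
    rw [← Real.rpow_one_add' hkpos.le (by linarith)]
    exact Real.rpow_le_rpow_of_exponent_le hk hab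
  have h2 : k ≤ k * k ^ b := le_mul_of_one_le_right hkpos.le (Real.one_le_rpow hk hb)
  rw [div_le_iff₀ hr0] at hk0
  rw [le_div_iff₀ hkpos]
  nlinarith

/-- Second differential inequality (10) of Lemma A.4: for
`N/2 − 1 + τ₁ ≤ α < N − 2`,
`−Δϖ_{r,α} ≥ C σ_k^{4−4α/(N−2)} ϖ_{r,N−2}^{2^*−2} ϖ_{r,α} + (α(N−2−α)/2) ϖ_{r,α+2}`
outside `P₁`. -/
theorem varpi_superharmonic_estimate_general_exponent
    (N : ℕ) (hN : 5 ≤ N)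
    (p : ℝ) (hp : p = 2 * N / ((N : ℝ) - 2))
    (m : ℝ) (hm1 : 2 ≤ m) (hm2 : m < (N : ℝ) - 2)
    (τ1 : ℝ) (hτ1 : τ1 = ((N : ℝ) - 2 - m) / ((N : ℝ) - 2))
    (r0 : ℝ) (hr0 : 0 < r0)
    (α : ℝ) (hα1 : (N : ℝ) / 2 - 1 + τ1 ≤ α) (hα2 : α < (N : ℝ) - 2) :
    ∃ C : ℝ, 0 < C ∧ ∃ k0 : ℕ,
      ∀ k : ℕ, k0 ≤ k →
        ∀ r ∈ Set.Icc (r0 * (k : ℝ) ^ (1 / τ1) - 1) (r0 * (k : ℝ) ^ (1 / τ1) + 1),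
          ∀ y : EuclideanSpace ℝ (Fin N),
            y ∉ (⋃ i ∈ Finset.Icc 1 k,
                  Metric.ball (circlePt N k r i) ((k : ℝ) ^ (1 / ((N : ℝ) - 2)))) →
              C * ((k : ℝ) ^ (1 / ((N : ℝ) - 2))) ^ (4 - 4 * α / ((N : ℝ) - 2)) *
                    varpi N k r ((N : ℝ) - 2) y ^ (p - 2) * varpi N k r α y
                  + (1 / 2) * α * ((N : ℝ) - 2 - α) * varpi N k r (α + 2) y ≤
                -laplacian (varpi N k r α) y := by
  have hN' : (5 : ℝ) ≤ N := by exact_mod_cast hN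
  have hn : 0 < (N : ℝ) - 2 := by linarith
  have hτpos : 0 < τ1 := by
    rw [hτ1]
    exact div_pos (by linarith) hn
  have hα0 : 0 < α := by linarith
  have hp2 : p - 2 = 4 / ((N : ℝ) - 2) := by
    rw [hp]
    field_simp
    ring
  have hτle : 1 + 1 / ((N : ℝ) - 2) ≤ 1 / τ1 := by
    rw [hτ1, one_div_div, ← sub_nonneg]
    have hm : 0 < (N : ℝ) - 2 - m := by linarith
    have : ((N : ℝ) - 2) / ((N : ℝ) - 2 - m) - (1 + 1 / ((N : ℝ) - 2)) =
        (m * ((N : ℝ) - 2) - ((N : ℝ) - 2 - m)) / (((N : ℝ) - 2 - m) * ((N : ℝ) - 2)) := by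
      field_simp
      ring
    rw [this]
    exact div_nonneg (by nlinarith) (by positivity)
  obtain ⟨K, hK, hle⟩ := exists_rpow_mul_varpi_le hN (α := α) (by linarith)
    (show 0 < r0 / 2 by positivity)
  have hαN : 0 < (1 / 2) * α * ((N : ℝ) - 2 - α) := mul_pos (by positivity) (by linarith)
  refine ⟨(1 / 2) * α * ((N : ℝ) - 2 - α) / K, div_pos hαN hK, ⌈2 / r0⌉₊ + 1,
    fun k hk r hr y hy => ?_⟩
  have hk1 : (1 : ℝ) ≤ k := by exact_mod_cast (by omega : 1 ≤ k)
  have hk2 : 2 / r0 ≤ k := Nat.ceil_le.1 (by omega)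
  set σ := (k : ℝ) ^ (1 / ((N : ℝ) - 2))
  have hσ1 : 1 ≤ σ := Real.one_le_rpow hk1 (by positivity)
  have hfar : ∀ i ∈ Icc 1 k, σ ≤ ‖y - circlePt N k r i‖ := by
    intro i hi
    by_contra! hlt
    exact hy (Set.mem_iUnion₂.2 ⟨i, hi, mem_ball_iff_norm.2 hlt⟩)
  have hne : ∀ i ∈ Icc 1 k, y ≠ circlePt N k r i := fun i hi =>
    sub_ne_zero.1 (norm_pos_iff.1 (by linarith [hfar i hi]))
  have h1 := hle k (by omega) r σ hσ1
    (mul_rpow_le_div_of_le hr0 hk1 hk2 (by positivity) hτle hr.1) y hfar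
  have h2 := mul_varpi_le_neg_laplacian_varpi (by omega) hα0.le hne
  rw [hp2]
  refine le_trans ?_ h2
  have h3 := mul_le_mul_of_nonneg_left h1 (div_pos hαN hK).le
  rw [← mul_assoc _ K, div_mul_cancel₀ _ hK.ne'] at h3
  linarith
end
end
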